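/- arXiv:1008.5176 — 13 statements merged into one kernel-verified Lean document; each statement's English description precedes it below -/
import Mathlib

section
/- Let 𝔸 be a commutative ring with identity and let a, b ∈ 𝔸 be such that the equation a·x + b·y = 1 has a solution in 𝔸. Then for all n ≥ 2 the matrix T_n(a,b) is unitarily equivalent to the n×n diagonal matrix diag(1, 1, …, 1, f_n(a,b)) whose first n−1 diagonal entries are 1 and whose last diagonal entry is f_n(a,b). -/
/-- The sequence `f_n(x,y)` with `f_0 = 1`, `f_1 = x`,
`f_n = x·f_{n-1} - y²·f_{n-2}`. -/
def fseq {A : Type*} [CommRing A] (x y : A) : ℕ → A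
  | 0 => 1
  | 1 => x
  | n + 2 => x * fseq x y (n + 1) - y ^ 2 * fseq x y n

/-- The tridiagonal matrix `T_n(a,b) = a·I_n + b·A(P_n)`. -/
def Tmat {A : Type*} [CommRing A] (n : ℕ) (a b : A) : Matrix (Fin n) (Fin n) A :=
  Matrix.of fun i j =>
    if i = j then a
    else if i.val + 1 = j.val ∨ j.val + 1 = i.val then b
    else 0

open Matrix in
/-- The block upper triangular matrix with diagonal blocks `1` and `M` and first row `(1, r)`. -/
def oneBlock {A : Type*} [CommRing A] {m : ℕ} (r : Fin m → A) (M : Matrix (Fin m) (Fin m) A) :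
    Matrix (Fin (m + 1)) (Fin (m + 1)) A :=
  Matrix.of (vecCons (vecCons 1 r) fun i => vecCons 0 (M i))

section oneBlock

open Matrix

variable {A : Type*} [CommRing A] {m : ℕ}

theorem det_oneBlock (r : Fin m → A) (M : Matrix (Fin m) (Fin m) A) :
    (oneBlock r M).det = M.det := by
  rw [det_succ_column_zero, Fin.sum_univ_succ]
  have hM : (oneBlock r M).submatrix Fin.succ Fin.succ = M := by
    ext i j
    simp [oneBlock]
  simp [oneBlock] at hM ⊢
  rw [hM]

theorem oneBlock_mul (r r' : Fin m → A) (M M' : Matrix (Fin m) (Fin m) A) :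
    oneBlock r M * oneBlock r' M' = oneBlock (r' + r ᵥ* M') (M * M') := by
  ext i j
  refine Fin.cases ?_ (fun i => ?_) i <;> refine Fin.cases ?_ (fun j => ?_) j <;>
    simp [oneBlock, Matrix.mul_apply, Fin.sum_univ_succ, vecMul, dotProduct]

end oneBlock

section rowPair

open Matrix

variable {A : Type*} [CommRing A]

/-- The identity matrix with upper left `2 × 2` block replaced by `!![s, t; p, q]`. -/
def rowPair (m : ℕ) (s t p q : A) : Matrix (Fin (m + 2)) (Fin (m + 2)) A :=
  Matrix.of (vecCons (vecCons s (vecCons t 0)) (vecCons (vecCons p (vecCons q 0))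
    fun i => vecCons 0 (vecCons 0 ((1 : Matrix (Fin m) (Fin m) A) i))))

theorem det_rowPair (m : ℕ) (s t p q : A) : (rowPair m s t p q).det = s * q - t * p := by
  have h0 : (rowPair m s t p q).submatrix (Fin.succAbove 0) Fin.succ =
      diagonal (Fin.cons q fun _ => 1) := by
    ext i j
    refine Fin.cases ?_ (fun i => ?_) i <;> refine Fin.cases ?_ (fun j => ?_) j <;>
      simp [rowPair, diagonal_apply, one_apply, eq_comm]
  have h1 : (rowPair m s t p q).submatrix (Fin.succAbove 1) Fin.succ =
      diagonal (Fin.cons t fun _ => 1) := by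
    ext i j
    refine Fin.cases ?_ (fun i => ?_) i <;> refine Fin.cases ?_ (fun j => ?_) j <;>
      simp [rowPair, diagonal_apply, one_apply, eq_comm]
  rw [det_succ_column_zero, Fin.sum_univ_succ, Fin.sum_univ_succ, Fin.succ_zero_eq_one, h0, h1,
    det_diagonal, det_diagonal, Fin.prod_univ_succ, Fin.prod_univ_succ]
  simp [rowPair]
  ring

end rowPair

theorem Tmat_apply {A : Type*} [CommRing A] (n : ℕ) (a b : A) (i j : Fin n) :
    Tmat n a b i j = if i.val = j.val then a
      else if i.val + 1 = j.val ∨ j.val + 1 = i.val then b else 0 := by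
  simp only [Tmat, Matrix.of_apply, Fin.ext_iff]

/-- The matrix `T_n(a,b)` with its first row replaced by `(u, v, 0, …, 0)`. -/
def tmatHead {A : Type*} [CommRing A] (a b u v : A) (m : ℕ) :
    Matrix (Fin (m + 1)) (Fin (m + 1)) A :=
  Matrix.of fun i j =>
    if i.val = 0 then if j.val = 0 then u else if j.val = 1 then v else 0
    else Tmat (m + 1) a b i j

theorem rowPair_mul_tmatHead {A : Type*} [CommRing A] (a b u v s t : A) (m : ℕ)
    (hst : s * u + t * b = 1) :
    ∃ r, rowPair m s t (-b) u * tmatHead a b u v (m + 1) =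
      oneBlock r (tmatHead a b (u * a - b * v) (u * b) m) := by
  refine ⟨fun j => s * tmatHead a b u v (m + 1) 0 j.succ +
    t * tmatHead a b u v (m + 1) 1 j.succ, ?_⟩
  ext i j
  refine Fin.cases ?_ (fun i => ?_) i
  · refine Fin.cases ?_ (fun j => ?_) j
    · simp [rowPair, Matrix.mul_apply, Fin.sum_univ_succ, oneBlock, tmatHead, Tmat_apply, hst]
    · simp [rowPair, Matrix.mul_apply, Fin.sum_univ_succ, oneBlock]
  · refine Fin.cases ?_ (fun i => ?_) i
    · refine Fin.cases ?_ (fun j => ?_) j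
      · simp [rowPair, Matrix.mul_apply, Fin.sum_univ_succ, oneBlock, tmatHead, Tmat_apply]
        ring
      · refine Fin.cases ?_ (fun j => ?_) j
        · simp [rowPair, Matrix.mul_apply, Fin.sum_univ_succ, oneBlock, tmatHead, Tmat_apply]
          ring
        · simp [rowPair, Matrix.mul_apply, Fin.sum_univ_succ, oneBlock, tmatHead, Tmat_apply,
            eq_comm]
    · have : (rowPair m s t (-b) u * tmatHead a b u v (m + 1)) i.succ.succ j =
          tmatHead a b u v (m + 1) i.succ.succ j := by
        simp [rowPair, Matrix.mul_apply, Fin.sum_univ_succ, Matrix.one_apply]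
      rw [this]
      refine Fin.cases ?_ (fun j => ?_) j
      · simp [oneBlock, tmatHead, Tmat_apply]
      · simp [oneBlock, tmatHead, Tmat_apply]

theorem isCoprime_fseq {A : Type*} [CommRing A] {a b : A} (h : IsCoprime a b) :
    ∀ k, IsCoprime (fseq a b k) b
  | 0 => isCoprime_one_left
  | 1 => h
  | k + 2 => by
    have := (h.mul_left (isCoprime_fseq h (k + 1))).add_mul_right_left (-(b * fseq a b k))
    convert this using 1
    rw [fseq]
    ring

theorem tmatHead_fseq_equiv_diagonal {A : Type*} [CommRing A] {a b : A} (h : IsCoprime a b)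
    (m k : ℕ) : ∃ P Q : Matrix (Fin (m + 1)) (Fin (m + 1)) A, P.det = 1 ∧ Q.det = 1 ∧
      Matrix.diagonal (fun i : Fin (m + 1) => if i.val = m then fseq a b (m + k + 1) else 1)
        = P * tmatHead a b (fseq a b (k + 1)) (b * fseq a b k) m * Q := by
  induction m generalizing k with
  | zero =>
    refine ⟨1, 1, Matrix.det_one, Matrix.det_one, ?_⟩
    ext i j
    fin_cases i; fin_cases j
    simp [tmatHead]
  | succ m ih =>
    obtain ⟨P, Q, hP, hQ, hPQ⟩ := ih (k + 1)
    obtain ⟨s, t, hst⟩ := isCoprime_fseq h (k + 1)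
    obtain ⟨r, hr⟩ := rowPair_mul_tmatHead a b (fseq a b (k + 1)) (b * fseq a b k) s t m hst
    refine ⟨oneBlock 0 P * rowPair m s t (-b) (fseq a b (k + 1)),
      oneBlock (-r) 1 * oneBlock 0 Q, ?_, ?_, ?_⟩
    · rw [Matrix.det_mul, det_oneBlock, det_rowPair, hP]
      linear_combination hst
    · simp [det_oneBlock, hQ]
    · have hu : fseq a b (k + 1) * a - b * (b * fseq a b k) = fseq a b (k + 1 + 1) := by
        rw [fseq]
        ring
      rw [hu, mul_comm _ b] at hr
      rw [Matrix.mul_assoc (oneBlock 0 P), hr, ← Matrix.mul_assoc, Matrix.mul_assoc (oneBlock 0 P),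
        oneBlock_mul, oneBlock_mul, oneBlock_mul]
      simp only [Matrix.vecMul_one, neg_add_cancel, Matrix.mul_one, Matrix.zero_vecMul, add_zero,
        ← hPQ]
      ext i j
      refine Fin.cases ?_ (fun i => ?_) i <;> refine Fin.cases ?_ (fun j => ?_) j <;>
        simp [oneBlock, Matrix.diagonal_apply, (Fin.succ_ne_zero _).symm, add_comm, add_left_comm]

/-- For `a, b` with `a·x + b·y = 1` solvable, `T_n(a,b)` is unitarily equivalent to
`diag(1, …, 1, f_n(a,b))` for all `n ≥ 2`. -/
theorem Tmat_unitarily_equiv_diagonal {A : Type*} [CommRing A] (a b : A)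
    (h : ∃ x y : A, a * x + b * y = 1) (n : ℕ) (hn : 2 ≤ n) :
    ∃ P Q : Matrix (Fin n) (Fin n) A, P.det = 1 ∧ Q.det = 1 ∧
      Matrix.diagonal (fun i : Fin n => if i.val = n - 1 then fseq a b n else 1)
        = P * Tmat n a b * Q := by
  obtain ⟨x, y, hxy⟩ := h
  obtain ⟨m, rfl⟩ : ∃ m, n = m + 1 := ⟨n - 1, by omega⟩
  have hT : tmatHead a b (fseq a b 1) (b * fseq a b 0) m = Tmat (m + 1) a b := by
    ext i j
    refine Fin.cases ?_ (fun i => ?_) i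
    · simp [tmatHead, Tmat_apply, fseq, eq_comm]
    · simp [tmatHead]
  have := tmatHead_fseq_equiv_diagonal (a := a) (b := b) ⟨x, y, by rw [← hxy]; ring⟩ m 0
  rwa [zero_add, hT] at this
end

section
/- Let 𝔸 be a commutative ring with identity and let a, b ∈ 𝔸 be such that the equation a·x + b·y = 1 has a solution in 𝔸. Then for all n ≥ 2 the matrix P_n(a,b) is unitarily equivalent to the n×n diagonal matrix diag(1, 1, …, 1, (a+2b)·f_{n−1}(a,b)) whose first n−1 diagonal entries are 1 and whose last diagonal entry is (a+2b)·f_{n−1}(a,b). -/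
/-- The tridiagonal matrix `P_n(a,b)` with diagonal `(a+b, a, …, a, a+b)` and
entries `b` on the sub/super-diagonal. -/
def Pmat {A : Type*} [CommRing A] (n : ℕ) (a b : A) : Matrix (Fin n) (Fin n) A :=
  Matrix.of fun i j =>
    if i = j then (if i.val = 0 ∨ i.val = n - 1 then a + b else a)
    else if i.val + 1 = j.val ∨ j.val + 1 = i.val then b
    else 0

/-- The block upper triangular matrix with first row `(c, r)` and lower right block `N`. -/
def cornerBlock {A : Type*} [CommRing A] {n : ℕ} (c : A) (r : Fin n → A)
    (N : Matrix (Fin n) (Fin n) A) : Matrix (Fin (n + 1)) (Fin (n + 1)) A :=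
  Matrix.of (Fin.cons (Fin.cons c r) fun i => Fin.cons 0 (N i))

theorem det_cornerBlock {A : Type*} [CommRing A] {n : ℕ} (c : A) (r : Fin n → A)
    (N : Matrix (Fin n) (Fin n) A) : (cornerBlock c r N).det = c * N.det := by
  have hN : (cornerBlock c r N).submatrix Fin.succ Fin.succ = N := by
    ext i j
    simp [cornerBlock]
  rw [Matrix.det_succ_column_zero, Fin.sum_univ_succ]
  simp [hN]
  simp [cornerBlock]

theorem cornerBlock_mul {A : Type*} [CommRing A] {n : ℕ} (c d : A) (r s : Fin n → A)
    (N K : Matrix (Fin n) (Fin n) A) :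
    cornerBlock c r N * cornerBlock d s K
      = cornerBlock (c * d) (c • s + Matrix.vecMul r K) (N * K) := by
  ext i j
  refine Fin.cases ?_ (fun i => ?_) i <;> refine Fin.cases ?_ (fun j => ?_) j <;>
    simp [cornerBlock, Matrix.mul_apply, Fin.sum_univ_succ, Matrix.vecMul, dotProduct]

/-- The tridiagonal matrix with diagonal `(u, d 1, …, d m)`, off-diagonal entries `b`, except that
the entry in position `(0, 1)` is `b * v`. -/
def headTridiag {A : Type*} [CommRing A] (b : A) (m : ℕ) (d : ℕ → A) (u v : A) :
    Matrix (Fin (m + 1)) (Fin (m + 1)) A :=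
  Matrix.of fun i j =>
    if i.val = 0 then (if j.val = 0 then u else if j.val = 1 then b * v else 0)
    else if i.val = j.val then d i.val
    else if i.val + 1 = j.val ∨ j.val + 1 = i.val then b
    else 0

/-- The determinant of `headTridiag b m d u v`, computed by eliminating the first column. -/
def headContinuant {A : Type*} [CommRing A] (b : A) : ℕ → (ℕ → A) → A → A → A
  | 0, _, u, _ => u
  | m + 1, d, u, v => headContinuant b m (fun i => d (i + 1)) (d 1 * u - b ^ 2 * v) u

/-- The `2 × 2` matrix `!![p, q; -b, u]` acting on the first two coordinates. -/
def headRowOp {A : Type*} [CommRing A] (m : ℕ) (p q b u : A) :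
    Matrix (Fin (m + 2)) (Fin (m + 2)) A :=
  Matrix.of (Fin.cons (Fin.cons p (Fin.cons q 0))
    fun i => Fin.cons (if i = 0 then -b else 0) (cornerBlock u 0 1 i))

theorem det_headRowOp {A : Type*} [CommRing A] (m : ℕ) (p q b u : A) :
    (headRowOp m p q b u).det = p * u + q * b := by
  have h₀ : (headRowOp m p q b u).submatrix Fin.succ Fin.succ = cornerBlock u 0 1 := by
    ext i j
    simp [headRowOp]
  have h₁ : (headRowOp m p q b u).submatrix Fin.succ (Fin.succAbove 1)
      = cornerBlock (-b) 0 1 := by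
    ext i j
    refine Fin.cases ?_ (fun i => ?_) i <;> refine Fin.cases ?_ (fun j => ?_) j <;>
      simp [headRowOp, cornerBlock]
  rw [Matrix.det_succ_row_zero, Fin.sum_univ_succ, Fin.sum_univ_succ]
  simp [h₀, h₁, det_cornerBlock]
  simp [headRowOp]

theorem exists_headRowOp_mul_headTridiag {A : Type*} [CommRing A] (b : A) (m : ℕ) (d : ℕ → A)
    (u v p q : A) (h : p * u + q * b = 1) :
    ∃ r, headRowOp m p q b u * headTridiag b (m + 1) d u v
      = cornerBlock 1 r (headTridiag b m (fun i => d (i + 1)) (d 1 * u - b ^ 2 * v) u) := by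
  refine ⟨fun j => (headRowOp m p q b u * headTridiag b (m + 1) d u v) 0 j.succ, ?_⟩
  ext i j
  refine Fin.cases ?_ (fun i => ?_) i
  · refine Fin.cases ?_ (fun j => ?_) j
    · simp [Matrix.mul_apply, Fin.sum_univ_succ, headRowOp, headTridiag, cornerBlock, h]
    · simp [cornerBlock]
  · refine Fin.cases ?_ (fun i => ?_) i
    · refine Fin.cases ?_ (fun j => ?_) j
      · simp [Matrix.mul_apply, Fin.sum_univ_succ, headRowOp, headTridiag, cornerBlock]
        ring
      · refine Fin.cases ?_ (fun j => ?_) j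
        · simp [Matrix.mul_apply, Fin.sum_univ_succ, headRowOp, headTridiag, cornerBlock]
          ring
        · simp [Matrix.mul_apply, Fin.sum_univ_succ, headRowOp, headTridiag, cornerBlock]
          split_ifs <;> grind
    · have hrow : headRowOp m p q b u i.succ.succ = Pi.single i.succ.succ 1 := by
        ext k
        refine Fin.cases ?_ (fun k => ?_) k
        · simp [headRowOp]
        · refine Fin.cases ?_ (fun k => ?_) k <;>
            simp [headRowOp, cornerBlock, Matrix.one_apply, Pi.single_apply, eq_comm,
              Fin.succ_succ_ne_one]
      have hmul : (headRowOp m p q b u * headTridiag b (m + 1) d u v) i.succ.succ j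
          = headTridiag b (m + 1) d u v i.succ.succ j := by
        rw [Matrix.mul_apply, hrow]
        simp [Pi.single_apply]
      rw [hmul]
      refine Fin.cases ?_ (fun j => ?_) j <;>
        simp [headTridiag, cornerBlock]

theorem headTridiag_equiv_diagonal {A : Type*} [CommRing A] (b : A) (m : ℕ) :
    ∀ (d : ℕ → A) (u v : A), (∀ i, IsCoprime (d i) b) → IsCoprime u b →
      ∃ P Q : Matrix (Fin (m + 1)) (Fin (m + 1)) A, P.det = 1 ∧ Q.det = 1 ∧
        Matrix.diagonal (fun i => if i.val = m then headContinuant b m d u v else 1)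
          = P * headTridiag b m d u v * Q := by
  induction m with
  | zero =>
    intro d u v _ _
    refine ⟨1, 1, Matrix.det_one, Matrix.det_one, ?_⟩
    ext i j
    fin_cases i
    fin_cases j
    simp [headTridiag, headContinuant]
  | succ m ih =>
    intro d u v hd hu
    have hu' : IsCoprime (d 1 * u - b ^ 2 * v) b := by
      have h := ((hd 1).mul_left hu).add_mul_left_left (-(b * v))
      convert h using 1
      ring
    obtain ⟨P, Q, hP, hQ, hPQ⟩ := ih (fun i => d (i + 1)) _ u (fun i => hd (i + 1)) hu'
    obtain ⟨p, q, hpq⟩ := hu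
    obtain ⟨r, hr⟩ := exists_headRowOp_mul_headTridiag b m d u v p q hpq
    refine ⟨cornerBlock 1 0 P * headRowOp m p q b u,
      cornerBlock 1 (-Matrix.vecMul r Q) Q, ?_, ?_, ?_⟩
    · rw [Matrix.det_mul, det_cornerBlock, det_headRowOp, hP, hpq, one_mul, one_mul]
    · rw [det_cornerBlock, hQ, one_mul]
    · rw [Matrix.mul_assoc (cornerBlock 1 0 P), hr, cornerBlock_mul, cornerBlock_mul, ← hPQ]
      ext i j
      refine Fin.cases ?_ (fun i => ?_) i <;> refine Fin.cases ?_ (fun j => ?_) j <;>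
        simp [cornerBlock, headContinuant, Matrix.diagonal_apply, Fin.succ_ne_zero,
          (Fin.succ_ne_zero _).symm]

theorem headContinuant_eq_fseq {A : Type*} [CommRing A] (a b : A) (m : ℕ) :
    ∀ (k : ℕ) (u v : A), u = fseq a b (k + 1) + b * fseq a b k →
      b ^ 2 * v = a * u - (fseq a b (k + 2) + b * fseq a b (k + 1)) →
      headContinuant b (m + 1) (fun i => if i = m + 1 then a + b else a) u v
        = (a + 2 * b) * fseq a b (k + 1 + m) := by
  induction m with
  | zero =>
    intro k u v hu hv
    simp only [headContinuant, if_true, zero_add, hv, hu, fseq, add_zero]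
    ring
  | succ m ih =>
    intro k u v hu hv
    have h := ih (k + 1) (a * u - b ^ 2 * v) u (by rw [hv]; ring)
      (by rw [hv, hu]; simp only [fseq]; ring)
    rw [headContinuant]
    simpa [add_assoc, add_comm, add_left_comm] using h

theorem Pmat_eq_headTridiag {A : Type*} [CommRing A] (a b : A) (m : ℕ) :
    Pmat (m + 2) a b
      = headTridiag b (m + 1) (fun i => if i = m + 1 then a + b else a) (a + b) 1 := by
  ext i j
  simp only [Pmat, headTridiag, Matrix.of_apply, Fin.ext_iff]
  grind

/-- For `a, b` with `a·x + b·y = 1` solvable, `P_n(a,b)` is unitarily equivalent to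
`diag(1, …, 1, (a+2b)·f_{n-1}(a,b))` for all `n ≥ 2`. -/
theorem Pmat_unitarily_equiv_diagonal {A : Type*} [CommRing A] (a b : A)
    (h : ∃ x y : A, a * x + b * y = 1) (n : ℕ) (hn : 2 ≤ n) :
    ∃ P Q : Matrix (Fin n) (Fin n) A, P.det = 1 ∧ Q.det = 1 ∧
      Matrix.diagonal
          (fun i : Fin n => if i.val = n - 1 then (a + 2 * b) * fseq a b (n - 1) else 1)
        = P * Pmat n a b * Q := by
  obtain ⟨x, y, hxy⟩ := h
  obtain ⟨m, rfl⟩ := Nat.exists_eq_add_of_le' hn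
  have ha : IsCoprime a b := ⟨x, y, by linear_combination hxy⟩
  have hab : IsCoprime (a + b) b := ⟨x, y - x, by linear_combination hxy⟩
  have hU := headContinuant_eq_fseq a b m 0 (a + b) 1 (by simp [fseq]) (by simp only [fseq]; ring)
  have hM := headTridiag_equiv_diagonal b (m + 1) (fun i => if i = m + 1 then a + b else a)
    (a + b) 1 (fun i => by split_ifs <;> assumption) hab
  rw [hU, ← Pmat_eq_headTridiag, zero_add, add_comm 1 m] at hM
  exact hM
end

section
/- Let 𝔸 be a commutative ring with identity and let a, b ∈ 𝔸 be such that the equation a·x + b·y = 1 has a solution in 𝔸. Then for all n ≥ 2 the matrix K_n(a,b) is unitarily equivalent to the n×n diagonal matrix diag(1, a, a, …, a, a·(a+n·b)) whose first diagonal entry is 1, whose next n−2 diagonal entries are a, and whose last diagonal entry is a·(a+n·b). -/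
open Matrix in
/-- Clearing the off-diagonal blocks of `a·I + b·J`, indexed by `Fin 2 ⊕ Fin m`, by unimodular
block-triangular matrices. -/
theorem scalar_add_const_block_reduction {A : Type*} [CommRing A] (m : ℕ) (a b : A) :
    ∃ P Q : Matrix (Fin 2 ⊕ Fin m) (Fin 2 ⊕ Fin m) A, P.det = 1 ∧ Q.det = 1 ∧
      P * (Matrix.of fun i j => if i = j then a + b else b) * Q
        = fromBlocks !![a + (m + 1) * b, b; (m + 1) * b, a + b] 0 0 (a • 1) := by
  let E : Matrix (Fin m) (Fin 2) A := Matrix.of fun _ => ![1, 0]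
  let F : Matrix (Fin 2) (Fin m) A := Matrix.of ![fun _ => 0, fun _ => 1]
  let J (p q : Type) : Matrix p q A := Matrix.of fun _ _ => b
  have hK : (Matrix.of fun i j => if i = j then a + b else b :
      Matrix (Fin 2 ⊕ Fin m) (Fin 2 ⊕ Fin m) A)
      = fromBlocks !![a + b, b; b, a + b] (J _ _) (J _ _) (a • 1 + J _ _) := by
    ext i j
    rcases i with i | i <;> rcases j with j | j
    · fin_cases i <;> fin_cases j <;> simp
    · simp [J]
    · simp [J]
    · by_cases hij : i = j <;> simp [J, hij]
  have hE : !![a + b, b; b, a + b] + J (Fin 2) (Fin m) * E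
      = !![a + (m + 1) * b, b; (m + 1) * b, a + b] := by
    ext i j
    fin_cases i <;> fin_cases j <;> simp [E, J, Matrix.mul_apply] <;> ring
  have hEA : E * !![a + (m + 1) * b, b; (m + 1) * b, a + b]
      = J (Fin m) (Fin 2) + (a • 1 + J (Fin m) (Fin m)) * E := by
    rw [Matrix.add_mul, Matrix.smul_mul, Matrix.one_mul]
    ext i j
    fin_cases j <;> simp [E, J, Matrix.mul_apply] <;> ring
  have hEb : E * J (Fin 2) (Fin m) = J (Fin m) (Fin m) := by
    ext i j
    simp [E, J, Matrix.mul_apply]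
  have hF : !![a + (m + 1) * b, b; (m + 1) * b, a + b] * F
      = J (Fin 2) (Fin m) + a • F := by
    ext i j
    fin_cases i <;> simp [F, J, Matrix.mul_apply] <;> ring
  refine ⟨fromBlocks 1 F 0 1 * fromBlocks 1 0 (-E) 1,
    fromBlocks 1 0 E 1 * fromBlocks 1 (-F) 0 1, by simp, by simp, ?_⟩
  calc _ = fromBlocks 1 F 0 1 * (fromBlocks 1 0 (-E) 1 *
        ((Matrix.of fun i j => if i = j then a + b else b) * fromBlocks 1 0 E 1)) *
          fromBlocks 1 (-F) 0 1 := by simp only [Matrix.mul_assoc]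
    _ = fromBlocks 1 F 0 1 *
        fromBlocks !![a + (m + 1) * b, b; (m + 1) * b, a + b] (J _ _) 0 (a • 1) *
          fromBlocks 1 (-F) 0 1 := by
      congr 2
      rw [hK, fromBlocks_multiply, fromBlocks_multiply]
      simp only [Matrix.mul_one, Matrix.one_mul, Matrix.mul_zero, Matrix.zero_mul, zero_add,
        add_zero, hE, Matrix.neg_mul, hEA, hEb]
      congr 1
      · exact neg_add_cancel _
      · abel
    _ = _ := by
      rw [fromBlocks_multiply, fromBlocks_multiply]
      simp only [Matrix.mul_one, Matrix.one_mul, Matrix.mul_zero, Matrix.zero_mul, zero_add,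
        add_zero, Matrix.mul_neg, Matrix.mul_smul, neg_zero, hF]
      congr 1
      abel

open Matrix in
/-- The `2 × 2` case: a matrix `[[a + c, b], [c, a + b]]` with `a`, `b` comaximal has Smith form
`diag(1, a·(a + b + c))`. -/
theorem two_by_two_smith_form {A : Type*} [CommRing A] {a b x y : A} (h : a * x + b * y = 1)
    (c : A) :
    ∃ P Q : Matrix (Fin 2) (Fin 2) A, P.det = 1 ∧ Q.det = 1 ∧
      P * !![a + c, b; c, a + b] * Q = !![1, 0; 0, a * (a + c + b)] := by
  refine ⟨!![y, x; -a, b] * !![1, 0; -1, 1],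
    !![1, 0; 1, 1] * (!![1, 0; -(y * (a + c + b)), 1] * !![0, -1; 1, 0]), ?_, ?_, ?_⟩
  · simp [det_fin_two]
    linear_combination h
  · simp [det_fin_two]
  · ext i j
    fin_cases i <;> fin_cases j <;> simp
    · linear_combination h
    · linear_combination (y * (a + c + b)) * h
    · ring
    · ring


/-- The matrix `K_n(a,b) = (a+b)·I_n + b·A(K_n)`: diagonal entries `a+b`,
off-diagonal entries `b`. -/
def Kmat {A : Type*} [CommRing A] (n : ℕ) (a b : A) : Matrix (Fin n) (Fin n) A :=
  Matrix.of fun i j => if i = j then a + b else b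

/-- For `a, b` with `a·x + b·y = 1` solvable, `K_n(a,b)` is unitarily equivalent to
`diag(1, a, …, a, a·(a+n·b))` for all `n ≥ 2`. -/
theorem Kmat_unitarily_equiv_diagonal {A : Type*} [CommRing A] (a b : A)
    (h : ∃ x y : A, a * x + b * y = 1) (n : ℕ) (hn : 2 ≤ n) :
    ∃ P Q : Matrix (Fin n) (Fin n) A, P.det = 1 ∧ Q.det = 1 ∧
      Matrix.diagonal
          (fun i : Fin n =>
            if i.val = 0 then 1
            else if i.val = n - 1 then a * (a + (n : A) * b)
            else a)
        = P * Kmat n a b * Q := by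
  obtain ⟨x, y, hxy⟩ := h
  obtain ⟨m, rfl⟩ : ∃ m, n = m + 2 := ⟨n - 2, by omega⟩
  obtain ⟨P, Q, hP, hQ, hPQ⟩ := scalar_add_const_block_reduction m a b
  obtain ⟨S, T, hS, hT, hST⟩ := two_by_two_smith_form hxy ((m + 1) * b)
  let e : Fin 2 ⊕ Fin m ≃ Fin (m + 2) :=
    (finSumFinEquiv.trans (finCongr (Nat.add_comm 2 m))).trans (Equiv.swap 1 (Fin.last (m + 1)))
  have he (i : Fin 2 ⊕ Fin m) : e i = Equiv.swap 1 (Fin.last (m + 1))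
      (Fin.cast (Nat.add_comm 2 m) (finSumFinEquiv i)) := rfl
  have he0 : e (Sum.inl 0) = 0 := by
    rw [he, finSumFinEquiv_apply_left]
    exact Equiv.swap_apply_of_ne_of_ne (by simp [Fin.ext_iff]) (by simp [Fin.ext_iff])
  have he1 : e (Sum.inl 1) = Fin.last (m + 1) := by
    rw [he, finSumFinEquiv_apply_left, show Fin.cast _ (Fin.castAdd m 1) = (1 : Fin (m + 2)) by
      ext; simp, Equiv.swap_apply_left]
  have hne0 (j : Fin m) : (e (Sum.inr j)).val ≠ 0 := fun hj => by
    have := e.injective ((Fin.ext hj : e (Sum.inr j) = 0).trans he0.symm)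
    simp at this
  have hne1 (j : Fin m) : (e (Sum.inr j)).val ≠ m + 1 := fun hj => by
    have := e.injective ((Fin.ext hj : e (Sum.inr j) = Fin.last (m + 1)).trans he1.symm)
    simp at this
  have hK : Kmat (m + 2) a b
      = (Matrix.of fun i j => if i = j then a + b else b :
        Matrix (Fin 2 ⊕ Fin m) (Fin 2 ⊕ Fin m) A).submatrix e.symm e.symm := by
    ext i j
    simp [Kmat]
  have hD : Matrix.diagonal (fun i : Fin (m + 2) =>
      if i.val = 0 then 1
      else if i.val = m + 2 - 1 then a * (a + ((m + 2 : ℕ) : A) * b)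
      else a)
      = (Matrix.fromBlocks !![1, 0; 0, a * (a + (m + 1) * b + b)] 0 0 (a • 1) :
        Matrix (Fin 2 ⊕ Fin m) (Fin 2 ⊕ Fin m) A).submatrix e.symm e.symm := by
    rw [show (Matrix.fromBlocks !![1, 0; 0, a * (a + (m + 1) * b + b)] 0 0 (a • 1) :
        Matrix (Fin 2 ⊕ Fin m) (Fin 2 ⊕ Fin m) A)
        = Matrix.diagonal (Sum.elim ![1, a * (a + (m + 1) * b + b)] fun _ => a) by
      ext i j
      rcases i with i | i <;> rcases j with j | j
      · fin_cases i <;> fin_cases j <;> simp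
      · simp
      · simp
      · simp [Matrix.diagonal_apply, Matrix.one_apply], Matrix.submatrix_diagonal_equiv]
    congr 1
    funext i
    obtain ⟨k, rfl⟩ := e.surjective i
    rw [Function.comp_apply, Equiv.symm_apply_apply]
    rcases k with k | k
    · fin_cases k
      · simp [he0]
      · simp [he1]
        ring
    · simp [hne0, hne1]
  refine ⟨(Matrix.fromBlocks S 0 0 1 * P).submatrix e.symm e.symm,
    (Q * Matrix.fromBlocks T 0 0 1).submatrix e.symm e.symm, ?_, ?_, ?_⟩
  · simp [hS, hP]
  · simp [hT, hQ]
  · rw [hD, hK, Matrix.submatrix_mul_equiv, Matrix.submatrix_mul_equiv]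
    congr 1
    rw [show ∀ X Y K Z W : Matrix (Fin 2 ⊕ Fin m) (Fin 2 ⊕ Fin m) A,
      X * Y * K * (Z * W) = X * (Y * K * Z) * W by intros; simp only [Matrix.mul_assoc], hPQ]
    simp [Matrix.fromBlocks_multiply, hST]
end

section
/- Let 𝔸 be a commutative ring with identity and let a, b ∈ 𝔸 be such that the equation a·x + b·y = 1 has a solution in 𝔸. Let n ≥ 4 with n − 2 = 2q even. Then the matrix C_n(a,b) is unitarily equivalent to the block diagonal matrix I_{n−2} ⊕ C, where C is the 2×2 matrix f_q(a,b)·[[a, 2b],[2b, a]]. -/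
/-- The matrix `C_n(a,b) = a·I_n + b·A(C_n)` where `A(C_n)` is the adjacency
matrix of the `n`-cycle. -/
def Cmat {A : Type*} [CommRing A] (n : ℕ) (a b : A) : Matrix (Fin n) (Fin n) A :=
  Matrix.of fun i j =>
    if i = j then a
    else if (i.val + 1) % n = j.val ∨ (j.val + 1) % n = i.val then b
    else 0

theorem Cmat_mulVec {A : Type*} [CommRing A] (k : ℕ) (hk : 1 ≤ k) (a b : A) (U : ℕ → A)
    (i : Fin (k + 2)) :
    ∑ j : Fin (k + 2), Cmat (k + 2) a b i j * U j =
      b * U (if (i : ℕ) = 0 then k + 1 else i - 1) + a * U i +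
        b * U (if (i : ℕ) = k + 1 then 0 else i + 1) := by
  have key : ∀ j : Fin (k + 2), Cmat (k + 2) a b i j * U j =
      (if j = (⟨if (i : ℕ) = 0 then k + 1 else i - 1, by split_ifs <;> omega⟩ : Fin (k + 2))
        then b * U j else 0) + (if j = i then a * U j else 0) +
      (if j = (⟨if (i : ℕ) = k + 1 then 0 else i + 1, by split_ifs <;> omega⟩ : Fin (k + 2))
        then b * U j else 0) := by
    intro j
    obtain ⟨i, hi⟩ := i
    obtain ⟨j, hj⟩ := j
    have e1 : (i + 1) % (k + 2) = if i = k + 1 then 0 else i + 1 := by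
      split_ifs with h
      · subst h; simp
      · exact Nat.mod_eq_of_lt (by omega)
    have e2 : (j + 1) % (k + 2) = if j = k + 1 then 0 else j + 1 := by
      split_ifs with h
      · subst h; simp
      · exact Nat.mod_eq_of_lt (by omega)
    simp only [Cmat, Matrix.of_apply, Fin.mk.injEq, e1, e2]
    split_ifs <;> first | omega | simp
  rw [Finset.sum_congr rfl fun j _ => key j]
  simp [Finset.sum_add_distrib]

theorem fseq_map {A B : Type*} [CommRing A] [CommRing B] (φ : A →+* B) (a b : A) :
    ∀ n, φ (fseq a b n) = fseq (φ a) (φ b) n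
  | 0 => by simp [fseq]
  | 1 => by simp [fseq]
  | n + 2 => by simp [fseq, fseq_map φ a b n, fseq_map φ a b (n + 1)]

/-- The sequence `fseq` with its index moved up by one, starting from the value `0`. -/
def fshift {A : Type*} [CommRing A] (a b : A) : ℕ → A
  | 0 => 0
  | n + 1 => fseq a b n

theorem fshift_add_two {A : Type*} [CommRing A] (a b : A) (n : ℕ) :
    fshift a b (n + 2) = a * fshift a b (n + 1) - b ^ 2 * fshift a b n := by
  cases n <;> simp [fshift, fseq]

theorem fshift_cassini {A : Type*} [CommRing A] (a b : A) (n : ℕ) :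
    fshift a b (n + 1) ^ 2 - fshift a b (n + 2) * fshift a b n = b ^ (2 * n) := by
  induction n with
  | zero => simp [fshift, fseq]
  | succ n ih =>
    have h := fshift_add_two a b (n + 1)
    rw [h]
    linear_combination b ^ 2 * ih + fshift a b (n + 2) * fshift_add_two a b n

/-- A solution of `b w_{i-1} + a w_i + b w_{i+1} = 0`, antisymmetric about `q + 1`. -/
def cycleSol {A : Type*} [CommRing A] (a b : A) (q i : ℕ) : A :=
  if i ≤ q + 1 then fshift a b (q + 1 - i) * (-b) ^ i
  else -(fshift a b (i - (q + 1)) * (-b) ^ (2 * q + 2 - i))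

theorem cycleSol_symm {A : Type*} [CommRing A] (a b : A) (q i : ℕ) (hi : i ≤ 2 * q + 2) :
    cycleSol a b q (2 * q + 2 - i) = -cycleSol a b q i := by
  unfold cycleSol
  rcases lt_trichotomy i (q + 1) with h | rfl | h
  · rw [if_neg (by omega), if_pos (by omega), show 2 * q + 2 - i - (q + 1) = q + 1 - i by omega,
      show 2 * q + 2 - (2 * q + 2 - i) = i by omega]
  · rw [if_pos (by omega), if_pos (by omega), show 2 * q + 2 - (q + 1) = q + 1 by omega]
    simp [fshift]
  · rw [if_pos (by omega), if_neg (by omega), show q + 1 - (2 * q + 2 - i) = i - (q + 1) by omega,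
      neg_neg]

theorem cycleSol_rec {A : Type*} [CommRing A] (a b : A) (q i : ℕ) (hi : i ≤ 2 * q) :
    b * cycleSol a b q i + a * cycleSol a b q (i + 1) + b * cycleSol a b q (i + 2) = 0 := by
  have left : ∀ i < q,
      b * cycleSol a b q i + a * cycleSol a b q (i + 1) + b * cycleSol a b q (i + 2) = 0 := by
    intro i hi
    obtain ⟨m, rfl⟩ := Nat.exists_eq_add_of_lt hi
    simp only [cycleSol]
    rw [if_pos (by omega), if_pos (by omega), if_pos (by omega),
      show i + m + 1 + 1 - i = m + 2 by omega, show i + m + 1 + 1 - (i + 1) = m + 1 by omega,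
      show i + m + 1 + 1 - (i + 2) = m by omega, fshift_add_two]
    ring
  rcases lt_trichotomy i q with h | rfl | h
  · exact left i h
  · have h0 : cycleSol a b i (i + 1) = 0 := by simp [cycleSol, fshift]
    have h1 := cycleSol_symm a b i i (by omega)
    rw [show 2 * i + 2 - i = i + 2 by omega] at h1
    rw [h0, h1]; ring
  · have h1 := left (2 * q - i) (by omega)
    have s0 := cycleSol_symm a b q i (by omega)
    have s1 := cycleSol_symm a b q (i + 1) (by omega)
    have s2 := cycleSol_symm a b q (i + 2) (by omega)
    rw [show 2 * q + 2 - i = 2 * q - i + 2 by omega] at s0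
    rw [show 2 * q + 2 - (i + 1) = 2 * q - i + 1 by omega] at s1
    rw [show 2 * q + 2 - (i + 2) = 2 * q - i by omega] at s2
    rw [s0, s1, s2] at h1
    linear_combination -h1

theorem cycleSol_zero {A : Type*} [CommRing A] (a b : A) (q : ℕ) :
    cycleSol a b q 0 = fseq a b q := by
  simp [cycleSol, fshift]

theorem cycleSol_casoratian {A : Type*} [CommRing A] (a b : A) (q : ℕ) (hq : 1 ≤ q) :
    cycleSol a b q 1 ^ 2 - cycleSol a b q 0 * cycleSol a b q 2 = b ^ (2 * q) := by
  obtain ⟨m, rfl⟩ := Nat.exists_eq_add_of_le' hq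
  simp only [cycleSol]
  rw [if_pos (by omega), if_pos (by omega), if_pos (by omega),
      show m + 1 + 1 - 0 = m + 2 by omega, show m + 1 + 1 - 1 = m + 1 by omega,
      show m + 1 + 1 - 2 = m by omega]
  linear_combination b ^ 2 * fshift_cassini a b m

theorem regular_deformation {A : Type*} [CommRing A] {a b x y : A} (h : a * x + b * y = 1) :
    Polynomial.C b + Polynomial.X * Polynomial.C a ∈ nonZeroDivisors (Polynomial A) := by
  by_contra hc
  obtain ⟨r, hr, h0⟩ := Polynomial.notMem_nonZeroDivisors_iff.1 hc
  apply hr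
  have hb : r * b = 0 := by simpa using congrArg (fun p => Polynomial.coeff p 0) h0
  have ha : r * a = 0 := by simpa using congrArg (fun p => Polynomial.coeff p 1) h0
  linear_combination (-r) * h + x * ha + y * hb

open Matrix in
theorem exists_right_inverse {A m n : Type*} [CommRing A] [Fintype m] [DecidableEq m]
    [Fintype n] {T : Matrix m n A} {W V : Matrix n m A} {X : Matrix m m A} {b : A} {k : ℕ}
    (hW : T * W + b • X = 1) (hV : T * V = b ^ k • 1) : ∃ W' : Matrix n m A, T * W' = 1 := by
  have step : ∀ l : ℕ, ∃ (W' : Matrix n m A) (X' : Matrix m m A), T * W' + b ^ l • X' = 1 := by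
    intro l
    induction l with
    | zero => exact ⟨0, 1, by simp⟩
    | succ l ih =>
      obtain ⟨W', X', h⟩ := ih
      refine ⟨W' + b ^ l • (W * X'), X * X', ?_⟩
      calc T * (W' + b ^ l • (W * X')) + b ^ (l + 1) • (X * X')
          = T * W' + b ^ l • ((T * W + b • X) * X') := by
            simp only [Matrix.mul_add, Matrix.add_mul, Matrix.mul_smul, Matrix.smul_mul,
              smul_add, smul_smul, Matrix.mul_assoc, pow_succ, add_assoc]
        _ = 1 := by rw [hW, Matrix.one_mul, h]
  obtain ⟨W', X', h⟩ := step k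
  refine ⟨W' + V * X', ?_⟩
  rw [Matrix.mul_add, ← Matrix.mul_assoc, hV, Matrix.smul_mul, Matrix.one_mul, h]

open Matrix in
theorem exists_block_reduction {A κ ρ : Type*} [CommRing A] [Fintype κ] [DecidableEq κ]
    [Fintype ρ] [DecidableEq ρ] {T : Matrix κ (κ ⊕ ρ) A} (S : Matrix ρ (κ ⊕ ρ) A)
    {E : Matrix ρ (κ ⊕ ρ) A} {W : Matrix (κ ⊕ ρ) κ A} {K : Matrix (κ ⊕ ρ) ρ A}
    (hW : T * W = 1) (hK : T * K = 0) (hreg : (fromRows T E).det ∈ nonZeroDivisors A)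
    (hdet : (E * K).det = (fromRows T E).det) :
    ∃ P Q : Matrix (κ ⊕ ρ) (κ ⊕ ρ) A, P.det = 1 ∧ Q.det = 1 ∧
      fromBlocks 1 0 0 (S * K) = P * fromRows T S * Q := by
  refine ⟨fromBlocks 1 0 (-(S * W)) 1, fromCols W K, by simp, ?_, ?_⟩
  · have h := congrArg det (fromRows_mul_fromCols T E W K)
    rw [hW, hK, det_fromBlocks_zero₁₂, det_one, one_mul, det_mul, hdet] at h
    exact (mem_nonZeroDivisors_iff.1 hreg).1 _ (by rw [mul_sub, h]; ring) |> sub_eq_zero.1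
  · rw [Matrix.mul_assoc, fromRows_mul_fromCols, fromBlocks_multiply, hW, hK]
    simp

open Matrix in
theorem Cmat_reduction_of_regular {A : Type*} [CommRing A] {a b x y : A}
    (h : a * x + b * y = 1) (hb : b ∈ nonZeroDivisors A) (q : ℕ) (hq : 1 ≤ q) :
    ∃ P Q : Matrix (Fin (2 * q + 2)) (Fin (2 * q + 2)) A, P.det = 1 ∧ Q.det = 1 ∧
      (Matrix.of fun i j : Fin (2 * q + 2) =>
          if i = j then (if i.val < 2 * q then 1 else fseq a b q * a)
          else if 2 * q ≤ i.val ∧ 2 * q ≤ j.val then fseq a b q * (2 * b)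
          else 0)
        = P * Cmat (2 * q + 2) a b * Q := by
  let e : Fin (2 * q) ⊕ Fin 2 ≃ Fin (2 * q + 2) := finSumFinEquiv
  have el : ∀ i, (e (Sum.inl i) : ℕ) = i := fun i => by simp [e]
  have er : ∀ i, (e (Sum.inr i) : ℕ) = 2 * q + i := fun i => by simp [e]
  let u := cycleSol a b q
  let C := (Cmat (2 * q + 2) a b).submatrix e e
  let E : Matrix (Fin 2) (Fin (2 * q) ⊕ Fin 2) A :=
    of fun i c => if e c = (if i = 0 then Fin.last _ else 0) then 1 else 0
  let U : Fin 2 → ℕ → A := fun j c =>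
    if j = 0 then (if c = 2 * q + 1 then -u 1 else -u (c + 2))
    else (if c = 2 * q + 1 then u 0 else u (c + 1))
  let K : Matrix (Fin (2 * q) ⊕ Fin 2) (Fin 2) A := of fun c j => U j (e c)
  let N : Matrix (Fin (2 * q)) (Fin (2 * q)) A :=
    of fun i j => if (i : ℕ) + 1 = j ∨ (j : ℕ) + 1 = i then 1 else 0
  have hCK : ∀ r j, (C * K) r j = b * U j (if (e r : ℕ) = 0 then 2 * q + 1 else e r - 1) +
      a * U j (e r) + b * U j (if (e r : ℕ) = 2 * q + 1 then 0 else e r + 1) := by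
    intro r j
    rw [← Cmat_mulVec (2 * q) (by omega) a b (U j) (e r), Matrix.mul_apply,
      ← Equiv.sum_comp e]
    rfl
  have hC : fromRows C.toRows₁ C.toRows₂ = C := fromRows_toRows C
  have hK : C.toRows₁ * K = 0 := by
    ext i j
    change (C * K) (Sum.inl i) j = 0
    have hi := i.2
    rw [hCK, el]
    rcases Fin.eq_zero_or_eq_succ j with rfl | ⟨j, rfl⟩
    · have n0 : (i : ℕ) ≠ 2 * q + 1 := by omega
      have n1 : (i : ℕ) + 1 ≠ 2 * q + 1 := by omega
      have := cycleSol_rec a b q (i + 1) (by omega)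
      rcases Nat.eq_zero_or_pos (i : ℕ) with h0 | h0
      · simp only [h0, U, ↓reduceIte] at n0 n1 this ⊢
        simp only [n0, n1, ↓reduceIte]
        linear_combination -this
      · have n2 : (i : ℕ) ≠ 0 := by omega
        have n3 : (i : ℕ) - 1 ≠ 2 * q + 1 := by omega
        simp only [U, n0, n1, n2, n3, ↓reduceIte]
        rw [show (i : ℕ) - 1 + 2 = i + 1 by omega]
        linear_combination -this
    · have n0 : (i : ℕ) ≠ 2 * q + 1 := by omega
      have n1 : (i : ℕ) + 1 ≠ 2 * q + 1 := by omega
      have := cycleSol_rec a b q i (by omega)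
      rcases Nat.eq_zero_or_pos (i : ℕ) with h0 | h0
      · simp only [h0, U, Fin.succ_ne_zero, ↓reduceIte] at n0 n1 this ⊢
        simp only [n0, n1, ↓reduceIte]
        linear_combination this
      · have n2 : (i : ℕ) ≠ 0 := by omega
        have n3 : (i : ℕ) - 1 ≠ 2 * q + 1 := by omega
        simp only [U, Fin.succ_ne_zero, n0, n1, n2, n3, ↓reduceIte]
        rw [show (i : ℕ) - 1 + 1 = i by omega]
        linear_combination this
  have hS : C.toRows₂ * K = of fun i j => if i = j then fseq a b q * a
      else fseq a b q * (2 * b) := by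
    ext i j
    change (C * K) (Sum.inr i) j = _
    rw [hCK, er]
    have u0 : u 0 = fseq a b q := cycleSol_zero a b q
    have s0 : u (2 * q + 2) = -u 0 := cycleSol_symm a b q 0 (by omega)
    have s1 : u (2 * q + 1) = -u 1 := cycleSol_symm a b q 1 (by omega)
    have r0 := cycleSol_rec a b q 0 (by omega)
    have r1 := cycleSol_rec a b q (2 * q) (by omega)
    change b * u 0 + a * u 1 + b * u 2 = 0 at r0
    change b * u (2 * q) + a * u (2 * q + 1) + b * u (2 * q + 2) = 0 at r1
    rw [s0, s1] at r1
    have e1 : 2 * q - 1 + 1 = 2 * q := by omega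
    have e2 : 2 * q - 1 + 2 = 2 * q + 1 := by omega
    have n0 : q ≠ 0 := by omega
    have n1 : ¬ (2 * q - 1 = 2 * q + 1) := by omega
    fin_cases i <;> fin_cases j <;> simp [U, e1, e2, n0, n1, s0, s1, ← u0]
    all_goals first | ring1 | linear_combination r0 | linear_combination -r0 | linear_combination r1
  have hdetZ : (fromRows C.toRows₁ E).det = -b ^ (2 * q) := by
    let σ : Equiv.Perm (Fin (2 * q) ⊕ Fin 2) := (e.trans (finRotate _)).trans e.symm
    have hσ : ((Equiv.Perm.sign σ : ℤ) : A) = -1 := by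
      simp only [σ, Equiv.Perm.sign_trans_trans_symm, sign_finRotate]
      rw [show 2 * q + 2 - 1 = 2 * q + 1 by omega, pow_succ, pow_mul]
      simp
    have hσv : ∀ c, e (σ c) = e c + 1 := by simp [σ]
    have hσl : ∀ j, (e (σ (Sum.inl j)) : ℕ) = j + 1 := by
      intro j
      rw [hσv, Fin.val_add_one_of_lt' (by rw [el]; omega), el]
    have hσ0 : e (σ (Sum.inr 0)) = Fin.last _ := by
      apply Fin.ext
      rw [hσv, Fin.val_add_one_of_lt' (by rw [er]; simp), er]
      simp
    have hσ1 : e (σ (Sum.inr 1)) = 0 := by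
      have : e (Sum.inr 1) = Fin.last _ := Fin.ext (by rw [er]; simp)
      rw [hσv, this, Fin.last_add_one]
    have hZ : ∀ i j, fromRows C.toRows₁ E (Sum.inl i) (σ (Sum.inl j)) =
        if (i : ℕ) = j + 1 then a else if (i : ℕ) = j ∨ (j : ℕ) + 2 = i then b else 0 := by
      intro i j
      have hi := i.2
      have hj := j.2
      change Cmat _ a b (e (Sum.inl i)) (e (σ (Sum.inl j))) = _
      simp only [Cmat, of_apply, Fin.ext_iff, hσl, el]
      rw [Nat.mod_eq_of_lt (by omega), Nat.mod_eq_of_lt (by omega)]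
      simp only [Nat.add_right_cancel_iff, Nat.add_assoc, Nat.reduceAdd]
    have hL : ((fromRows C.toRows₁ E).submatrix id σ) =
        fromBlocks (of fun i j => fromRows C.toRows₁ E (Sum.inl i) (σ (Sum.inl j)))
          (of fun i j => fromRows C.toRows₁ E (Sum.inl i) (σ (Sum.inr j))) 0 1 := by
      ext (i | i) (j | j)
      · rfl
      · rfl
      · have : e (σ (Sum.inl j)) ≠ if i = 0 then Fin.last _ else 0 := by
          rw [Ne, Fin.ext_iff, hσl]
          split_ifs
          all_goals simp
          omega
        simp [E, this]
      · fin_cases i <;> fin_cases j <;> simp [E, hσ0, hσ1]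
    have h1 := det_permute' σ (fromRows C.toRows₁ E)
    rw [hL, hσ, det_fromBlocks_zero₂₁, det_one, mul_one, det_of_isLowerTriangular] at h1
    · have h2 : ∀ i : Fin (2 * q), (i : ℕ) ≠ i + 1 := fun i => by omega
      simp only [of_apply, hZ, h2, true_or, if_true, if_false, Finset.prod_const,
        Finset.card_univ, Fintype.card_fin] at h1
      rw [h1]
      ring
    · intro i j hij
      have hij' : (i : ℕ) < j := hij
      rw [of_apply, hZ, if_neg (by omega), if_neg (by omega)]
  have hEK : (E * K).det = -b ^ (2 * q) := by
    have hE : ∀ i j, (E * K) i j = U j (if i = 0 then 2 * q + 1 else 0) := by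
      intro i j
      rw [Matrix.mul_apply, ← Equiv.sum_comp e.symm]
      rw [Finset.sum_eq_single (if i = 0 then Fin.last _ else 0)]
      · simp [E, K]
        split_ifs <;> simp
      · intro c _ hc
        simp [E, hc]
      · simp
    rw [det_fin_two, hE, hE, hE, hE]
    have := cycleSol_casoratian a b q hq
    simp [U]
    linear_combination -this
  have hX : C.toRows₁ * (fromRows (x • 1) 0 : Matrix (Fin (2 * q) ⊕ Fin 2) (Fin (2 * q)) A) +
      b • (y • 1 - x • N) = 1 := by
    have e0 : C.toRows₁ * (fromRows (x • 1) 0 : Matrix (Fin (2 * q) ⊕ Fin 2) (Fin (2 * q)) A) = x • C.toBlocks₁₁ := by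
      ext i j
      rw [Matrix.mul_apply, Fintype.sum_sum_type]
      simp [Matrix.one_apply, toBlocks₁₁, mul_comm]
    have e1 : C.toBlocks₁₁ = a • 1 + b • N := by
      ext i j
      have hi := i.2
      have hj := j.2
      have m1 : ((i : ℕ) + 1) % (2 * q + 2) = i + 1 := Nat.mod_eq_of_lt (by omega)
      have m2 : ((j : ℕ) + 1) % (2 * q + 2) = j + 1 := Nat.mod_eq_of_lt (by omega)
      simp only [toBlocks₁₁, C, N, Cmat, of_apply, submatrix_apply, Matrix.add_apply,
        Matrix.smul_apply, el, m1, m2, e.apply_eq_iff_eq, Sum.inl.injEq, Matrix.one_apply,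
        smul_eq_mul]
      by_cases hij : i = j
      · subst hij; simp
      · simp [hij]
    rw [e0, e1]
    calc x • (a • 1 + b • N) + b • (y • 1 - x • N) = (a * x + b * y) • 1 := by module
      _ = 1 := by rw [h, one_smul]
  have hV : C.toRows₁ * (-(fromRows C.toRows₁ E).adjugate.toCols₁) = b ^ (2 * q) • 1 := by
    rw [Matrix.mul_neg]
    ext i j
    have h1 := congrFun₂ (mul_adjugate (fromRows C.toRows₁ E)) (Sum.inl i) (Sum.inl j)
    rw [hdetZ] at h1
    change -((fromRows C.toRows₁ E * (fromRows C.toRows₁ E).adjugate) (Sum.inl i) (Sum.inl j)) = _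
    rw [h1]
    by_cases hij : i = j <;> simp [hij]
  obtain ⟨W, hW⟩ := exists_right_inverse hX hV
  obtain ⟨P, Q, hP, hQ, hPQ⟩ := exists_block_reduction C.toRows₂ hW hK
    (E := E) (by rw [hdetZ]; rw [neg_eq_neg_one_mul]; exact mul_mem (isUnit_one.neg.mem_nonZeroDivisors) (pow_mem hb _)) (by rw [hdetZ, hEK])
  rw [hC, hS] at hPQ
  refine ⟨P.submatrix e.symm e.symm, Q.submatrix e.symm e.symm, by simpa, by simpa, ?_⟩
  have hT : fromBlocks 1 0 0 (of fun i j : Fin 2 => if i = j then fseq a b q * a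
      else fseq a b q * (2 * b)) = (of fun i j : Fin (2 * q + 2) =>
        if i = j then (if i.val < 2 * q then 1 else fseq a b q * a)
        else if 2 * q ≤ i.val ∧ 2 * q ≤ j.val then fseq a b q * (2 * b)
        else 0).submatrix e e := by
    ext (i | i) (j | j) <;>
      simp [el, er, e.apply_eq_iff_eq, Matrix.one_apply, not_le_of_gt i.2]
  rw [hT] at hPQ
  have h3 := congrArg (fun M => M.submatrix e.symm e.symm) hPQ
  simp only [← submatrix_mul_equiv _ _ e.symm e.symm e.symm] at h3
  simpa [C] using h3

/-- For `n ≥ 4` with `n - 2 = 2q` even, `C_n(a,b)` is unitarily equivalent to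
`I_{n-2} ⊕ f_q(a,b)·[[a, 2b],[2b, a]]`. -/
theorem Cmat_unitarily_equiv_even {A : Type*} [CommRing A] (a b : A)
    (h : ∃ x y : A, a * x + b * y = 1) (n q : ℕ) (hn : 4 ≤ n) (hq : n - 2 = 2 * q) :
    ∃ P Q : Matrix (Fin n) (Fin n) A, P.det = 1 ∧ Q.det = 1 ∧
      (Matrix.of fun i j : Fin n =>
          if i = j then (if i.val < n - 2 then 1 else fseq a b q * a)
          else if n - 2 ≤ i.val ∧ n - 2 ≤ j.val then fseq a b q * (2 * b)
          else 0)
        = P * Cmat n a b * Q := by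
  obtain ⟨x, y, h⟩ := h
  obtain rfl : n = 2 * q + 2 := by omega
  simp only [Nat.add_sub_cancel]
  have h' : Polynomial.C a * (Polynomial.C x - Polynomial.X * Polynomial.C y) +
      (Polynomial.C b + Polynomial.X * Polynomial.C a) * Polynomial.C y = 1 := by
    have := congrArg Polynomial.C h
    simp only [map_add, map_mul, map_one] at this
    linear_combination this
  obtain ⟨P, Q, hP, hQ, hPQ⟩ :=
    Cmat_reduction_of_regular h' (regular_deformation h) q (by omega)
  let φ : Polynomial A →+* A := Polynomial.evalRingHom 0
  have ha : φ (Polynomial.C a) = a := by simp [φ]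
  have hb : φ (Polynomial.C b + Polynomial.X * Polynomial.C a) = b := by simp [φ]
  refine ⟨P.map φ, Q.map φ, ?_, ?_, ?_⟩
  · rw [← RingHom.mapMatrix_apply, ← RingHom.map_det, hP, map_one]
  · rw [← RingHom.mapMatrix_apply, ← RingHom.map_det, hQ, map_one]
  · have h1 := congrArg (fun M => M.map φ) hPQ
    simp only [Matrix.map_mul] at h1
    convert h1 using 1
    · ext i j
      simp only [Matrix.map_apply, Matrix.of_apply, apply_ite φ, map_mul, fseq_map, ha, hb,
        map_one, map_zero, map_ofNat]
    · congr 2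
      ext i j
      simp only [Cmat, Matrix.map_apply, Matrix.of_apply, apply_ite φ, ha, hb, map_zero]
end

section
/- Let 𝔸 be a commutative ring with identity and let a, b ∈ 𝔸 be such that the equation a·x + b·y = 1 has a solution in 𝔸. Let n ≥ 4 with n − 2 = 2q + 1 odd. Then the matrix C_n(a,b) is unitarily equivalent to the block diagonal matrix I_{n−2} ⊕ C, where C is the 2×2 diagonal matrix (f_{q+1}(a,b) − b·f_q(a,b))·[[1, 0],[0, a+2b]]. -/
namespace CycleMatrix

open Matrix

variable {A : Type*} [CommRing A]

/-- If replacing one column of `M` gives a matrix of determinant one, then `M` can be reduced to a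
diagonal matrix with a single entry `det M` and all other entries `1`. -/
theorem exists_diagonal_of_det_updateCol {ι : Type*} [Fintype ι] [DecidableEq ι]
    (M : Matrix ι ι A) (k : ι) (c : ι → A) (hc : (M.updateCol k c).det = 1) :
    ∃ P Q : Matrix ι ι A, P.det = 1 ∧ Q.det = 1 ∧
      P * M * Q = diagonal (fun i => if i = k then M.det else 1) := by
  set N := M.updateCol k c with hN
  have hNN : N.adjugate * N = 1 := by rw [adjugate_mul, hc, one_smul]
  set w := N.adjugate *ᵥ (fun i => M i k) with hw
  have hwk : w k = M.det := by
    have h1 : N.adjugate *ᵥ (fun i => M i k) = N.cramer (fun i => M i k) := by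
      rw [cramer_eq_adjugate_mulVec]
    rw [hw, h1, cramer_apply, hN]
    congr 1
    ext i j
    by_cases h : j = k <;> simp [h]
  have hM : N.adjugate * M = (1 : Matrix ι ι A).updateCol k w := by
    ext i j
    by_cases h : j = k
    · subst h
      simp [hw, mul_apply, mulVec, dotProduct]
    · have h1 : (N.adjugate * N) i j = (1 : Matrix ι ι A) i j := by rw [hNN]
      rw [updateCol_ne h, ← h1]
      simp [mul_apply, hN, h]
  refine ⟨N.adjugate, (1 : Matrix ι ι A).updateCol k (fun i => if i = k then 1 else -w i),
    ?_, ?_, ?_⟩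
  · have := congrArg det hNN
    rwa [det_mul, hc, mul_one, det_one] at this
  · rw [← cramer_apply]
    simp
  · rw [hM]
    have hsplit : ∀ v : ι → A, (1 : Matrix ι ι A).updateCol k w *ᵥ v
        = fun i => v i + (w i - if i = k then 1 else 0) * v k := by
      intro v
      ext i
      have : ∀ j, (1 : Matrix ι ι A).updateCol k w i j
          = (1 : Matrix ι ι A) i j + if j = k then (w i - if i = k then 1 else 0) else 0 := by
        intro j
        by_cases h : j = k
        · subst h; simp [one_apply]
        · simp [h]
      simp only [mulVec, dotProduct, this, add_mul, Finset.sum_add_distrib]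
      simp [one_apply]
    ext i j
    have := congrFun (hsplit (fun l => (1 : Matrix ι ι A).updateCol k
      (fun i => if i = k then 1 else -w i) l j)) i
    rw [mul_apply]
    simp only [mulVec, dotProduct] at this
    rw [this]
    by_cases h : j = k
    · subst h
      by_cases hi : i = j
      · subst hi; simp [hwk]
      · simp [hi]
    · rw [updateCol_ne h, updateCol_ne h, one_apply_ne (Ne.symm h)]
      by_cases hi : i = j
      · subst hi; simp [h]
      · simp [hi]

/-- The tridiagonal matrix with diagonal `α`, superdiagonal `β` and constant subdiagonal `c`. -/
def tridiag (α β : ℕ → A) (c : A) (m : ℕ) : Matrix (Fin m) (Fin m) A :=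
  of fun i j => if i.val = j.val then α j else if i.val + 1 = j.val then β i
    else if i.val = j.val + 1 then c else 0

theorem det_tridiag_add_two (α β : ℕ → A) (c : A) (m : ℕ) :
    (tridiag α β c (m + 2)).det =
      α (m + 1) * (tridiag α β c (m + 1)).det - c * β m * (tridiag α β c m).det := by
  rw [det_succ_row _ (Fin.last _), Fin.sum_univ_castSucc, Fin.sum_univ_castSucc,
    Finset.sum_eq_zero, zero_add]
  · have h1 : (tridiag α β c (m + 2)).submatrix (Fin.last (m + 1)).succAbove
        (Fin.last (m + 1)).succAbove = tridiag α β c (m + 1) := by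
      ext i j; simp [tridiag]
    have h2 : ((tridiag α β c (m + 2)).submatrix (Fin.last (m + 1)).succAbove
        ((Fin.last m).castSucc).succAbove).det = β m * (tridiag α β c m).det := by
      rw [det_succ_column _ (Fin.last _), Fin.sum_univ_castSucc, Finset.sum_eq_zero, zero_add]
      · have h3 : (((tridiag α β c (m + 2)).submatrix (Fin.last (m + 1)).succAbove
            ((Fin.last m).castSucc).succAbove).submatrix (Fin.last m).succAbove
            (Fin.last m).succAbove) = tridiag α β c m := by
          ext i j
          simp [tridiag, Fin.succAbove, Fin.lt_def]
        rw [h3]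
        simp [tridiag, ← two_mul]
      · intro i _
        have := i.isLt
        have h4 : ¬ (i.val = m + 1) := by omega
        have h5 : ¬ (i.val = m) := by omega
        have h6 : ¬ (i.val = m + 2) := by omega
        simp [tridiag, h4, h5, h6]
    rw [h1, h2]
    have h7 : (-1 : A) ^ (m + 1 + m) = -1 := Odd.neg_one_pow ⟨m, by ring⟩
    have h8 : (-1 : A) ^ (m + 1 + (m + 1)) = 1 := Even.neg_one_pow ⟨m + 1, by ring⟩
    have hdiag : tridiag α β c (m + 2) (Fin.last (m + 1)) (Fin.last (m + 1)) = α (m + 1) := by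
      simp [tridiag]
    have hsub : tridiag α β c (m + 2) (Fin.last (m + 1)) (Fin.last m).castSucc = c := by
      have h9 : ¬ (m + 1 + 1 = m) := by omega
      simp [tridiag, h9]
    rw [hdiag, hsub]
    simp only [Fin.val_last, Fin.val_castSucc, h7, h8]
    ring
  · intro j _
    have := j.isLt
    have h4 : ¬ (m + 1 = j.val) := by omega
    have h5 : ¬ (m = j.val) := by omega
    have h6 : ¬ (m + 1 + 1 = j.val) := by omega
    simp [tridiag, h4, h5, h6]

theorem det_tridiag_zero (α β : ℕ → A) (c : A) : (tridiag α β c 0).det = 1 := by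
  simp

theorem det_tridiag_one (α β : ℕ → A) (c : A) : (tridiag α β c 1).det = α 0 := by
  simp [tridiag]

theorem isCoprime_det_tridiag (α β : ℕ → A) (c : A) (hα : ∀ i, IsCoprime c (α i)) (m : ℕ) :
    IsCoprime c (tridiag α β c m).det := by
  induction m with
  | zero => rw [det_tridiag_zero]; exact isCoprime_one_right
  | succ m ih =>
    cases m with
    | zero => rw [det_tridiag_one]; exact hα 0
    | succ m =>
      rw [det_tridiag_add_two]
      have := ((hα (m + 1)).mul_right ih).add_mul_left_right (-(β m * (tridiag α β c m).det))
      convert this using 1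
      ring

/-- A tridiagonal matrix whose diagonal entries are coprime to the constant subdiagonal reduces to
its determinant, placed in the last diagonal position. -/
theorem exists_diagonal_tridiag (α β : ℕ → A) (c : A) (hα : ∀ i, IsCoprime c (α i)) (m : ℕ) :
    ∃ P Q : Matrix (Fin (m + 1)) (Fin (m + 1)) A, P.det = 1 ∧ Q.det = 1 ∧
      P * tridiag α β c (m + 1) * Q =
        diagonal (fun i => if i = Fin.last m then (tridiag α β c (m + 1)).det else 1) := by
  set M := tridiag α β c (m + 1) with hM
  have hfirst : M.adjugate (Fin.last m) 0 = (-1) ^ m * c ^ m := by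
    rw [adjugate_fin_succ_eq_det_submatrix, det_of_isUpperTriangular]
    · have h0 : ∀ k : ℕ, ¬ (k + 1 + 1 = k) := by omega
      simp [hM, tridiag, h0]
    · intro i j hij
      have : j.val < i.val := hij
      have h1 : ¬ (i.val + 1 = j.val) := by omega
      have h2 : ¬ (i.val + 1 + 1 = j.val) := by omega
      have h3 : ¬ (i.val = j.val) := by omega
      simp [hM, tridiag, h1, h2, h3]
  have hlast : M.adjugate (Fin.last m) (Fin.last m) = (tridiag α β c m).det := by
    rw [adjugate_fin_succ_eq_det_submatrix]
    have : M.submatrix (Fin.last m).succAbove (Fin.last m).succAbove = tridiag α β c m := by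
      ext i j; simp [hM, tridiag]
    rw [this, Even.neg_one_pow ⟨_, rfl⟩, one_mul]
  obtain ⟨x, y, hxy⟩ := (isCoprime_det_tridiag α β c hα m).pow_left (m := m)
  refine exists_diagonal_of_det_updateCol M (Fin.last m)
    ((x * (-1) ^ m) • Pi.single 0 1 + y • Pi.single (Fin.last m) 1) ?_
  rw [← cramer_apply, cramer_eq_adjugate_mulVec, mulVec_add, mulVec_smul, mulVec_smul]
  simp only [mulVec_single_one, Pi.add_apply, Pi.smul_apply, col_apply, hfirst, hlast,
    smul_eq_mul]
  have : ((-1 : A) ^ m) * (-1) ^ m = 1 := by rw [← mul_pow]; simp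
  linear_combination hxy + x * c ^ m * this

theorem sum_tridiag_smul {V : Type*} [AddCommGroup V] [Module A V] (α β : ℕ → A) (c : A)
    (m : ℕ) (v : ℕ → V) (j : Fin m) :
    ∑ i : Fin m, tridiag α β c m i j • v i =
      α j • v j + (if j.val = 0 then 0 else β (j - 1) • v (j - 1))
        + if j.val + 1 = m then 0 else c • v (j + 1) := by
  have hterm : ∀ i : ℕ, (if i = j.val then α j else if i + 1 = j.val then β i
      else if i = j.val + 1 then c else 0) • v i =
      (if i = j.val then α j • v j else 0)
      + (if i = j.val - 1 then (if j.val = 0 then 0 else β (j - 1) • v (j - 1)) else 0)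
      + (if i = j.val + 1 then c • v (j + 1) else 0) := by
    intro i
    rcases lt_trichotomy i j.val with h | h | h
    · by_cases h' : i + 1 = j.val
      · have h1 : i = j.val - 1 := by omega
        have h2 : ¬ j.val = 0 := by omega
        have h3 : ¬ j.val - 1 = j.val := by omega
        have h4 : ¬ j.val - 1 = j.val + 1 := by omega
        have h5 : j.val - 1 + 1 = j.val := by omega
        subst h1
        simp [h2, h3, h4, h5]
      · have h1 : ¬ i = j.val - 1 := by omega
        have h2 : ¬ i = j.val := by omega
        have h3 : ¬ i = j.val + 1 := by omega
        simp [h', h1, h2, h3]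
    · subst h
      by_cases h0 : j.val = 0
      · simp [h0]
      · have h1 : ¬ j.val = j.val - 1 := by omega
        simp [h1]
    · have h2 : ¬ i = j.val := by omega
      have h3 : ¬ i + 1 = j.val := by omega
      have h4 : ¬ i = j.val - 1 := by omega
      by_cases h' : i = j.val + 1
      · subst h'; simp [h3, h4]
      · simp [h', h2, h3, h4]
  have hj := j.isLt
  simp only [tridiag, of_apply]
  rw [Fin.sum_univ_eq_sum_range (fun i => (if i = j.val then α j else if i + 1 = j.val then β i
      else if i = j.val + 1 then c else 0) • v i) m]
  simp only [hterm, Finset.sum_add_distrib, Finset.sum_ite_eq', Finset.mem_range]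
  have h1 : j.val - 1 < m := by omega
  have h2 : j.val + 1 < m ↔ ¬ (j.val + 1 = m) := by omega
  simp [hj, h1, h2]

/-- The standard basis vectors of `Fin n → A`, indexed cyclically by the integers. -/
def cyc (A : Type*) [CommRing A] (n : ℕ) (z : ℤ) : Fin n → A :=
  fun i => if (n : ℤ) ∣ i.val - z then 1 else 0

theorem cyc_eq_of_dvd (n : ℕ) {z w : ℤ} (h : (n : ℤ) ∣ z - w) : cyc A n z = cyc A n w := by
  ext i
  have : (n : ℤ) ∣ i.val - z ↔ (n : ℤ) ∣ i.val - w := by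
    have e : (i.val - w : ℤ) = (i.val - z) + (z - w) := by ring
    rw [e]
    exact (dvd_add_left h).symm
  simp [cyc, this]

theorem dvd_iff_of_lt_two_mul {n : ℕ} {x : ℤ} (h₁ : -(2 * n) < x) (h₂ : x < 2 * n) :
    (n : ℤ) ∣ x ↔ x = 0 ∨ x = n ∨ x = -n := by
  constructor
  · rintro ⟨c, rfl⟩
    have hc₁ : c < 2 := by by_contra!; nlinarith
    have hc₂ : -2 < c := by by_contra!; nlinarith
    have : c = -1 ∨ c = 0 ∨ c = 1 := by omega
    rcases this with rfl | rfl | rfl <;> simp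
  · rintro (rfl | rfl | rfl) <;> simp

theorem cyc_val (n : ℕ) (j : Fin n) : cyc A n j.val = Pi.single j 1 := by
  ext i
  have hi := i.isLt
  have hj := j.isLt
  rw [cyc, Pi.single_apply]
  congr 1
  rw [dvd_iff_of_lt_two_mul (by omega) (by omega), Fin.ext_iff]
  apply propext
  omega

theorem Cmat_apply_eq_cyc (n : ℕ) (hn : 3 ≤ n) (a b : A) (i j : Fin n) :
    Cmat n a b i j = a * cyc A n j.val i + b * cyc A n (j.val + 1) i
      + b * cyc A n (j.val - 1) i := by
  have hi := i.isLt
  have hj := j.isLt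
  have hmod : ∀ k < n, (k + 1) % n = if k + 1 = n then 0 else k + 1 := by
    intro k hk
    split_ifs with h
    · rw [h, Nat.mod_self]
    · exact Nat.mod_eq_of_lt (by omega)
  simp only [Cmat, of_apply, cyc, hmod _ hi, hmod _ hj, Fin.ext_iff]
  simp only [dvd_iff_of_lt_two_mul (n := n) (x := i.val - j.val) (by omega) (by omega),
    dvd_iff_of_lt_two_mul (n := n) (x := i.val - (j.val + 1)) (by omega) (by omega),
    dvd_iff_of_lt_two_mul (n := n) (x := i.val - (j.val - 1)) (by omega) (by omega)]
  split_ifs <;> first | omega | simp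

theorem Cmat_mulVec_cyc (n : ℕ) (hn : 3 ≤ n) (a b : A) (z : ℤ) :
    Cmat n a b *ᵥ cyc A n z = a • cyc A n z + b • cyc A n (z + 1) + b • cyc A n (z - 1) := by
  have hn0 : (0 : ℤ) < n := by omega
  obtain ⟨j, hj⟩ : ∃ j : Fin n, (n : ℤ) ∣ z - j.val := by
    have h0 := Int.emod_nonneg z hn0.ne'
    have h1 := Int.emod_lt_of_pos z hn0
    refine ⟨⟨(z % n).toNat, by omega⟩, ?_⟩
    simp only [Int.toNat_of_nonneg h0]
    exact Int.dvd_self_sub_emod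
  rw [cyc_eq_of_dvd n hj, cyc_eq_of_dvd n (z := z + 1) (w := j.val + 1) (by simpa using hj),
    cyc_eq_of_dvd n (z := z - 1) (w := j.val - 1) (by simpa using hj)]
  ext i
  rw [cyc_val, mulVec_single_one, col_apply, Cmat_apply_eq_cyc n hn, cyc_val]
  simp

/-- The vectors symmetric under the reflection `z ↦ -z`. -/
def symmVec (A : Type*) [CommRing A] (n k : ℕ) : Fin n → A :=
  if k = 0 then cyc A n 0 else cyc A n k + cyc A n (-k)

/-- The vectors antisymmetric under the reflection `z ↦ 1 - z`. -/
def antisymmVec (A : Type*) [CommRing A] (n k : ℕ) : Fin n → A :=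
  cyc A n (k + 1) - cyc A n (-k)

/-- The action of `Cmat` on the symmetric vectors. -/
def symmBlock (a b : A) (q : ℕ) : Matrix (Fin (q + 2)) (Fin (q + 2)) A :=
  tridiag (fun i => if i = q + 1 then a + b else a) (fun i => if i = 0 then 2 * b else b) b (q + 2)

/-- The action of `Cmat` on the antisymmetric vectors. -/
def antisymmBlock (a b : A) (q : ℕ) : Matrix (Fin (q + 1)) (Fin (q + 1)) A :=
  tridiag (fun i => if i = 0 then a - b else a) (fun _ => b) b (q + 1)

theorem Cmat_mulVec_symmVec (a b : A) (q : ℕ) (j : Fin (q + 2)) :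
    Cmat (2 * q + 3) a b *ᵥ symmVec A (2 * q + 3) j =
      ∑ i : Fin (q + 2), symmBlock a b q i j • symmVec A (2 * q + 3) i := by
  rw [symmBlock, sum_tridiag_smul]
  obtain ⟨k, hk⟩ := j
  simp only
  rcases Nat.eq_zero_or_pos k with rfl | hpos
  · simp [symmVec, Cmat_mulVec_cyc]
    module
  obtain ⟨k, rfl⟩ : ∃ l, k = l + 1 := ⟨k - 1, by omega⟩
  have e1 : (-((k + 1 : ℕ) : ℤ) + 1) = -(k : ℤ) := by push_cast; ring
  have e2 : (((k + 1 : ℕ) : ℤ) - 1) = (k : ℤ) := by push_cast; ring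
  have e3 : (((k + 1 : ℕ) : ℤ) + 1) = ((k + 1 + 1 : ℕ) : ℤ) := by push_cast; ring
  have e4 : (-((k + 1 : ℕ) : ℤ) - 1) = -((k + 1 + 1 : ℕ) : ℤ) := by push_cast; ring
  have hL : Cmat (2 * q + 3) a b *ᵥ symmVec A (2 * q + 3) (k + 1) =
      a • symmVec A (2 * q + 3) (k + 1) + b • (cyc A (2 * q + 3) k + cyc A (2 * q + 3) (-k))
        + b • symmVec A (2 * q + 3) (k + 1 + 1) := by
    simp only [symmVec, Nat.add_eq_zero_iff, one_ne_zero, and_false, if_false, mulVec_add,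
      Cmat_mulVec_cyc _ (by omega : 3 ≤ 2 * q + 3), e1, e2, e3, e4]
    module
  have hprev : b • (cyc A (2 * q + 3) k + cyc A (2 * q + 3) (-k)) =
      (if k = 0 then 2 * b else b) • symmVec A (2 * q + 3) k := by
    by_cases h : k = 0
    · subst h
      simp [symmVec]
      module
    · simp [symmVec, h]
  rw [hL, hprev]
  by_cases hq : k = q
  · subst hq
    have hw : symmVec A (2 * k + 3) (k + 1 + 1) = symmVec A (2 * k + 3) (k + 1) := by
      have h1 : cyc A (2 * k + 3) ((k + 1 + 1 : ℕ) : ℤ) = cyc A (2 * k + 3) (-((k + 1 : ℕ) : ℤ)) :=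
        cyc_eq_of_dvd _ ⟨1, by push_cast; ring⟩
      have h2 : cyc A (2 * k + 3) (-((k + 1 + 1 : ℕ) : ℤ)) = cyc A (2 * k + 3) ((k + 1 : ℕ) : ℤ) :=
        cyc_eq_of_dvd _ ⟨-1, by push_cast; ring⟩
      simp only [symmVec, Nat.add_eq_zero_iff, one_ne_zero, and_false, if_false, h1, h2]
      exact add_comm _ _
    rw [hw]
    simp
    module
  · simp [hq]

theorem Cmat_mulVec_antisymmVec (a b : A) (q : ℕ) (j : Fin (q + 1)) :
    Cmat (2 * q + 3) a b *ᵥ antisymmVec A (2 * q + 3) j =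
      ∑ i : Fin (q + 1), antisymmBlock a b q i j • antisymmVec A (2 * q + 3) i := by
  rw [antisymmBlock, sum_tridiag_smul]
  obtain ⟨k, hk⟩ := j
  simp only
  have e1 : (-(k : ℤ) - 1) = -((k + 1 : ℕ) : ℤ) := by push_cast; ring
  have e2 : ((k : ℤ) + 1 + 1) = ((k + 1 : ℕ) : ℤ) + 1 := by push_cast; ring
  have e3 : ((k : ℤ) + 1 - 1) = k := by ring
  have hL : Cmat (2 * q + 3) a b *ᵥ antisymmVec A (2 * q + 3) k =
      a • antisymmVec A (2 * q + 3) k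
        + b • (cyc A (2 * q + 3) k - cyc A (2 * q + 3) (-k + 1))
        + b • antisymmVec A (2 * q + 3) (k + 1) := by
    simp only [antisymmVec, mulVec_sub, Cmat_mulVec_cyc _ (by omega : 3 ≤ 2 * q + 3), e1, e2, e3]
    module
  have hnext : b • antisymmVec A (2 * q + 3) (k + 1) =
      if k + 1 = q + 1 then 0 else b • antisymmVec A (2 * q + 3) (k + 1) := by
    by_cases h : k = q
    · subst h
      have h1 : cyc A (2 * k + 3) (((k + 1 : ℕ) : ℤ) + 1)
          = cyc A (2 * k + 3) (-((k + 1 : ℕ) : ℤ)) :=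
        cyc_eq_of_dvd _ ⟨1, by push_cast; ring⟩
      rw [if_pos rfl, antisymmVec, h1, sub_self, smul_zero]
    · simp [h]
  rw [hL, ← hnext]
  congr 1
  rcases Nat.eq_zero_or_pos k with rfl | hpos
  · simp [antisymmVec]
    module
  obtain ⟨k, rfl⟩ : ∃ l, k = l + 1 := ⟨k - 1, by omega⟩
  have e4 : (-((k + 1 : ℕ) : ℤ) + 1) = -(k : ℤ) := by push_cast; ring
  have e5 : ((k + 1 : ℕ) : ℤ) = (k : ℤ) + 1 := by push_cast; ring
  simp [antisymmVec]

/-- The matrix whose columns are the symmetric and antisymmetric vectors. -/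
def basisMat (A : Type*) [CommRing A] (q : ℕ) :
    Matrix (Fin (2 * q + 3)) (Fin (q + 2) ⊕ Fin (q + 1)) A :=
  of fun i j => Sum.elim (fun k : Fin (q + 2) => symmVec A (2 * q + 3) k i)
    (fun k : Fin (q + 1) => antisymmVec A (2 * q + 3) k i) j

theorem Cmat_mul_basisMat (a b : A) (q : ℕ) :
    Cmat (2 * q + 3) a b * basisMat A q =
      basisMat A q * fromBlocks (symmBlock a b q) 0 0 (antisymmBlock a b q) := by
  ext i (j | j)
  · have := congrFun (Cmat_mulVec_symmVec a b q j) i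
    simp only [mulVec, dotProduct, Finset.sum_apply, Pi.smul_apply, smul_eq_mul] at this
    simp [mul_apply, basisMat, this, mul_comm]
  · have := congrFun (Cmat_mulVec_antisymmVec a b q j) i
    simp only [mulVec, dotProduct, Finset.sum_apply, Pi.smul_apply, smul_eq_mul] at this
    simp [mul_apply, basisMat, this, mul_comm]

theorem basisMat_mulVec_surjective (q : ℕ) :
    Function.Surjective (basisMat A q).mulVec := by
  set W := LinearMap.range (basisMat A q).mulVecLin with hW
  have hcol : ∀ j, (basisMat A q).col j ∈ W := fun j =>
    ⟨Pi.single j 1, by simp⟩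
  have hs : ∀ k < q + 2, symmVec A (2 * q + 3) k ∈ W := fun k hk => hcol (Sum.inl ⟨k, hk⟩)
  have hd : ∀ k < q + 1, antisymmVec A (2 * q + 3) k ∈ W := fun k hk => hcol (Sum.inr ⟨k, hk⟩)
  have key : ∀ k : ℕ, k < q + 2 →
      cyc A (2 * q + 3) k ∈ W ∧ cyc A (2 * q + 3) (-k) ∈ W := by
    intro k
    induction k with
    | zero =>
      intro h
      have := hs 0 h
      simpa [symmVec] using this
    | succ k ih =>
      intro h
      have h1 : cyc A (2 * q + 3) ((k + 1 : ℕ) : ℤ) ∈ W := by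
        have := W.add_mem (hd k (by omega)) (ih (by omega)).2
        simpa [antisymmVec] using this
      refine ⟨h1, ?_⟩
      have := W.sub_mem (hs (k + 1) h) h1
      simpa [symmVec] using this
  have htop : ∀ i : Fin (2 * q + 3), (Pi.single i 1 : Fin (2 * q + 3) → A) ∈ W := by
    intro i
    rw [← cyc_val]
    by_cases h : i.val < q + 2
    · exact (key _ h).1
    · have := (key (2 * q + 3 - i.val) (by omega)).2
      rwa [cyc_eq_of_dvd (2 * q + 3) (w := (i.val : ℤ)) ⟨-1, by push_cast [i.isLt.le]; ring⟩] at this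
  intro v
  have hv : v ∈ W := by
    rw [← Finset.univ_sum_single v]
    refine W.sum_mem fun i _ => ?_
    have := W.smul_mem (v i) (htop i)
    rwa [← Pi.single_smul, smul_eq_mul, mul_one] at this
  obtain ⟨w, hw⟩ := hv
  exact ⟨w, hw⟩

theorem det_antisymmBlock (a b : A) (q : ℕ) :
    (antisymmBlock a b q).det = fseq a b (q + 1) - b * fseq a b q := by
  rw [antisymmBlock]
  induction q using Nat.twoStepInduction with
  | zero => rw [det_tridiag_one]; simp [fseq]
  | one =>
    rw [det_tridiag_add_two, det_tridiag_one, det_tridiag_zero]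
    simp [fseq]
    ring
  | more q h0 h1 =>
    rw [det_tridiag_add_two, h0, h1]
    simp [fseq]
    ring

theorem det_symmBlock (a b : A) (q : ℕ) :
    (symmBlock a b q).det = (fseq a b (q + 1) - b * fseq a b q) * (a + 2 * b) := by
  set α : ℕ → A := fun i => if i = q + 1 then a + b else a with hα
  set β : ℕ → A := fun i => if i = 0 then 2 * b else b with hβ
  have key : ∀ m, m ≤ q → (tridiag α β b (m + 1)).det = 2 * fseq a b (m + 1) - a * fseq a b m := by
    intro m
    induction m using Nat.twoStepInduction with
    | zero =>
      intro _
      rw [det_tridiag_one]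
      simp [hα, fseq]
      ring
    | one =>
      intro h
      have h1 : ¬ (1 = q + 1) := by omega
      rw [det_tridiag_add_two, det_tridiag_one, det_tridiag_zero]
      simp only [hα, hβ, h1, fseq]
      simp
      ring
    | more m h0 h1 =>
      intro h
      have h2 : ¬ (m + 1 + 1 = q + 1) := by omega
      rw [det_tridiag_add_two, h0 (by omega), h1 (by omega)]
      simp only [hα, hβ, h2, fseq]
      simp
      ring
  rw [symmBlock, det_tridiag_add_two, key q le_rfl]
  cases q with
  | zero =>
    rw [det_tridiag_zero]
    simp [fseq]
    ring
  | succ q =>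
    rw [key q (by omega)]
    simp [fseq]
    ring

/-- The interleaving equivalence sending `inl k` to `2 * k` and `inr k` to `2 * k + 1`. -/
def interleave (q : ℕ) : Fin (q + 2) ⊕ Fin (q + 1) ≃ Fin (2 * q + 3) where
  toFun := Sum.elim (fun k => ⟨2 * k, by omega⟩) (fun k => ⟨2 * k + 1, by omega⟩)
  invFun i := if h : i.val % 2 = 0 then Sum.inl ⟨i / 2, by omega⟩ else Sum.inr ⟨i / 2, by omega⟩
  left_inv := by
    rintro (k | k)
    · simp
    · simp [Fin.ext_iff]
      omega
  right_inv i := by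
    by_cases h : i.val % 2 = 0
    · simp [h, Fin.ext_iff]
      omega
    · simp [h, Fin.ext_iff]
      omega

end CycleMatrix

/-- For `n ≥ 4` with `n - 2 = 2q + 1` odd, `C_n(a,b)` is unitarily equivalent to
`I_{n-2} ⊕ (f_{q+1}(a,b) - b·f_q(a,b))·[[1, 0],[0, a+2b]]`. -/
theorem Cmat_unitarily_equiv_odd {A : Type*} [CommRing A] (a b : A)
    (h : ∃ x y : A, a * x + b * y = 1) (n q : ℕ) (hn : 4 ≤ n)
    (hq : n - 2 = 2 * q + 1) :
    ∃ P Q : Matrix (Fin n) (Fin n) A, P.det = 1 ∧ Q.det = 1 ∧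
      Matrix.diagonal
          (fun i : Fin n =>
            if i.val < n - 2 then 1
            else if i.val = n - 2 then fseq a b (q + 1) - b * fseq a b q
            else (fseq a b (q + 1) - b * fseq a b q) * (a + 2 * b))
        = P * Cmat n a b * Q := by
  open Matrix CycleMatrix in
  obtain ⟨x, y, hxy⟩ := h
  obtain rfl : n = 2 * q + 3 := by omega
  have hba : IsCoprime b a := ⟨y, x, by linear_combination hxy⟩
  have hbs : IsCoprime b (a + b) := ⟨y - x, x, by linear_combination hxy⟩
  have hbd : IsCoprime b (a - b) := ⟨y + x, x, by linear_combination hxy⟩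
  obtain ⟨P₁, Q₁, hP₁, hQ₁, h₁⟩ := exists_diagonal_tridiag
    (fun i => if i = q + 1 then a + b else a) (fun i => if i = 0 then 2 * b else b) b
    (by intro i; split_ifs <;> assumption) (q + 1)
  obtain ⟨P₂, Q₂, hP₂, hQ₂, h₂⟩ := exists_diagonal_tridiag
    (fun i => if i = 0 then a - b else a) (fun _ => b) b
    (by intro i; split_ifs <;> assumption) q
  change P₁ * symmBlock a b q * Q₁ = diagonal fun i =>
    if i = Fin.last (q + 1) then (symmBlock a b q).det else 1 at h₁
  change P₂ * antisymmBlock a b q * Q₂ = diagonal fun i =>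
    if i = Fin.last q then (antisymmBlock a b q).det else 1 at h₂
  rw [det_symmBlock] at h₁
  rw [det_antisymmBlock] at h₂
  set e := interleave q with he
  set D : Fin (2 * q + 3) → A := fun i =>
    if i.val < 2 * q + 3 - 2 then 1
    else if i.val = 2 * q + 3 - 2 then fseq a b (q + 1) - b * fseq a b q
    else (fseq a b (q + 1) - b * fseq a b q) * (a + 2 * b) with hD
  set T := fromBlocks (symmBlock a b q) 0 0 (antisymmBlock a b q) with hT
  set P := fromBlocks P₁ 0 0 P₂ with hP
  set Q := fromBlocks Q₁ 0 0 Q₂ with hQ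
  have hPTQ : P * T * Q = diagonal (D ∘ e) := by
    simp only [hP, hT, hQ, fromBlocks_multiply, Matrix.mul_zero, Matrix.zero_mul, add_zero,
      zero_add, h₁, h₂, fromBlocks_diagonal]
    congr 1
    ext (i | i)
    · have hi := i.isLt
      simp only [Sum.elim_inl, Function.comp, hD, he, interleave, Equiv.coe_fn_mk, Fin.ext_iff,
        Fin.val_last]
      split_ifs <;> first | rfl | omega
    · have hi := i.isLt
      simp only [Sum.elim_inr, Function.comp, hD, he, interleave, Equiv.coe_fn_mk, Fin.ext_iff,
        Fin.val_last]
      split_ifs <;> first | rfl | omega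
  set S := (basisMat A q).submatrix id e.symm with hS
  have hCS : Cmat (2 * q + 3) a b * S = S * T.submatrix e.symm e.symm := by
    rw [hS, submatrix_mul_equiv, hT, ← Cmat_mul_basisMat]
    ext i j
    simp [mul_apply]
  have hSunit : IsUnit S := by
    rw [← mulVec_surjective_iff_isUnit]
    intro v
    obtain ⟨w, hw⟩ := basisMat_mulVec_surjective (A := A) q v
    refine ⟨w ∘ e.symm, ?_⟩
    rw [hS, submatrix_mulVec_equiv, ← hw]
    ext i
    simp [Function.comp_def]
  have hdet : IsUnit S.det := (isUnit_iff_isUnit_det S).mp hSunit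
  obtain ⟨u, hu⟩ := hdet
  have hdetS : S⁻¹.det = (↑u⁻¹ : A) := by
    have h3 : S.det * S⁻¹.det = 1 := by
      rw [← det_mul, mul_nonsing_inv _ ((isUnit_iff_isUnit_det S).mp hSunit), det_one]
    rw [← hu] at h3
    exact (Units.inv_eq_of_mul_eq_one_right h3).symm
  have hconj : S⁻¹ * Cmat (2 * q + 3) a b * S = T.submatrix e.symm e.symm := by
    rw [Matrix.mul_assoc, hCS, ← Matrix.mul_assoc,
      nonsing_inv_mul _ ((isUnit_iff_isUnit_det S).mp hSunit), Matrix.one_mul]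
  have hdiag : P.submatrix e.symm e.symm * T.submatrix e.symm e.symm * Q.submatrix e.symm e.symm
      = diagonal D := by
    rw [submatrix_mul_equiv, submatrix_mul_equiv, hPTQ, submatrix_diagonal_equiv]
    congr 1
    ext i
    simp
  have hscale : ∀ c : A,
      (diagonal (Function.update (1 : Fin (2 * q + 3) → A) 0 c)).det = c := by
    intro c
    rw [det_diagonal, Finset.prod_update_of_mem (Finset.mem_univ _)]
    simp
  refine ⟨diagonal (Function.update 1 0 (u : A)) * (P.submatrix e.symm e.symm * S⁻¹),
    (S * Q.submatrix e.symm e.symm) * diagonal (Function.update 1 0 (↑u⁻¹ : A)), ?_, ?_, ?_⟩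
  · rw [det_mul, det_mul, hscale, det_submatrix_equiv_self, hdetS, hP, det_fromBlocks_zero₂₁,
      hP₁, hP₂]
    simp
  · rw [det_mul, det_mul, hscale, det_submatrix_equiv_self, ← hu, hQ, det_fromBlocks_zero₂₁,
      hQ₁, hQ₂]
    simp
  · have h4 : diagonal (Function.update 1 0 (u : A)) * (P.submatrix e.symm e.symm * S⁻¹)
        * Cmat (2 * q + 3) a b
        * ((S * Q.submatrix e.symm e.symm) * diagonal (Function.update 1 0 (↑u⁻¹ : A)))
        = diagonal (Function.update 1 0 (u : A)) * (P.submatrix e.symm e.symm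
          * (S⁻¹ * Cmat (2 * q + 3) a b * S) * Q.submatrix e.symm e.symm)
          * diagonal (Function.update 1 0 (↑u⁻¹ : A)) := by
      simp only [Matrix.mul_assoc]
    rw [h4, hconj, hdiag, diagonal_mul_diagonal, diagonal_mul_diagonal]
    congr 1
    ext i
    by_cases hi : i = 0
    · subst hi
      simp only [Function.update_self]
      rw [mul_right_comm, Units.mul_inv, one_mul]
    · simp [Function.update_of_ne hi]
end

section
/- Let 𝔸 be a commutative ring with identity and x, y ∈ 𝔸. For every n ≥ 1, f_n(x+y, −1) − f_n(y, −1) = x · Σ_{i=0}^{n−1} f_i(x+y, −1) · f_{n−1−i}(y, −1). -/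
theorem sum_fseq_mul_fseq_add_two {A : Type*} [CommRing A] (a b t : A) (n : ℕ) :
    ∑ i ∈ Finset.range (n + 2), fseq a t i * fseq b t (n + 1 - i) =
      b * ∑ i ∈ Finset.range (n + 1), fseq a t i * fseq b t (n - i) -
        t ^ 2 * ∑ i ∈ Finset.range n, fseq a t i * fseq b t (n - 1 - i) + fseq a t (n + 1) := by
  have h : ∑ i ∈ Finset.range n, fseq a t i * fseq b t (n + 1 - i) =
      b * ∑ i ∈ Finset.range n, fseq a t i * fseq b t (n - i) -
        t ^ 2 * ∑ i ∈ Finset.range n, fseq a t i * fseq b t (n - 1 - i) := by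
    rw [Finset.mul_sum, Finset.mul_sum, ← Finset.sum_sub_distrib]
    refine Finset.sum_congr rfl fun i hi => ?_
    obtain ⟨k, rfl⟩ := Nat.exists_eq_add_of_lt (Finset.mem_range.mp hi)
    rw [show i + k + 1 + 1 - i = k + 2 by lia, show i + k + 1 - i = k + 1 by lia,
      show i + k + 1 - 1 - i = k by lia, fseq]
    ring
  rw [Finset.sum_range_succ, Finset.sum_range_succ, h, Finset.sum_range_succ _ n]
  simp only [Nat.add_sub_cancel_left, Nat.sub_self, fseq]
  ring

theorem fseq_sub_fseq {A : Type*} [CommRing A] (a b t : A) (n : ℕ) :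
    fseq a t n - fseq b t n =
      (a - b) * ∑ i ∈ Finset.range n, fseq a t i * fseq b t (n - 1 - i) := by
  induction n using Nat.twoStepInduction with
  | zero => simp [fseq]
  | one => simp [fseq]
  | more n ih₀ ih₁ =>
    rw [show n + 2 - 1 = n + 1 from rfl, sum_fseq_mul_fseq_add_two, fseq, fseq]
    rw [Nat.add_sub_cancel] at ih₁
    linear_combination b * ih₁ - t ^ 2 * ih₀

/-- For all `n ≥ 1`,
`f_n(x+y, -1) - f_n(y, -1) = x · Σ_{i=0}^{n-1} f_i(x+y, -1) · f_{n-1-i}(y, -1)`. -/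
theorem fseq_sub_eq_mul_sum {A : Type*} [CommRing A] (x y : A) (n : ℕ) (hn : 1 ≤ n) :
    fseq (x + y) (-1) n - fseq y (-1) n =
      x * ∑ i ∈ Finset.range n, fseq (x + y) (-1) i * fseq y (-1) (n - 1 - i) := by
  rw [fseq_sub_fseq, add_sub_cancel_right]
end

section
/- Let 𝔸 be a commutative ring with identity and x, y ∈ 𝔸. For every n ≥ 1 and every k with 0 ≤ k ≤ n, x^k · f_n(x,y) = Σ_{i=0}^{k} C(k, i) · y^{2i} · f_{n+k−2i}(x,y), where C(k, i) denotes the binomial coefficient. -/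
theorem mul_fseq_succ {A : Type*} [CommRing A] (x y : A) (m : ℕ) :
    x * fseq x y (m + 1) = fseq x y (m + 2) + y ^ 2 * fseq x y m := by
  rw [fseq]
  ring

/-- For all `n ≥ 1` and `0 ≤ k ≤ n`,
`x^k · f_n(x,y) = Σ_{i=0}^{k} C(k,i) · y^(2i) · f_{n+k-2i}(x,y)`. -/
theorem pow_mul_fseq_eq_sum {A : Type*} [CommRing A] (x y : A) (n k : ℕ)
    (hn : 1 ≤ n) (hk : k ≤ n) :
    x ^ k * fseq x y n =
      ∑ i ∈ Finset.range (k + 1), (k.choose i : A) * y ^ (2 * i) * fseq x y (n + k - 2 * i) := by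
  induction k with
  | zero => simp
  | succ k ih =>
    have h := Finset.sum_choose_succ_mul
      (fun i _ => y ^ (2 * i) * fseq x y (n + (k + 1) - 2 * i)) k
    simp only [← mul_assoc] at h
    rw [h, pow_succ', mul_assoc, ih (by lia), Finset.mul_sum, ← Finset.sum_add_distrib]
    refine Finset.sum_congr rfl fun i hi => ?_
    have hik : i ≤ k := Finset.mem_range_succ_iff.mp hi
    obtain ⟨m, hm⟩ : ∃ m, n + k - 2 * i = m + 1 := ⟨n + k - 2 * i - 1, by lia⟩
    rw [hm, show n + (k + 1) - 2 * i = m + 2 by lia,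
      show n + (k + 1) - 2 * (i + 1) = m by lia, mul_left_comm, mul_fseq_succ]
    ring
end

section
/- Let 𝔸 be a commutative ring with identity, let m ≥ 2, n ≥ 2, and let A = (a_{i,j}) and B = (b_{i,j}) be n×n matrices over 𝔸. Let Φ_m(A,B) be the nm×nm block matrix whose (i,j) block (1 ≤ i,j ≤ n) is the m×m matrix K_m(a_{i,j}, b_{i,j}). Then Φ_m(A,B) is elementary equivalent to the block diagonal matrix consisting of m−2 copies of A followed by the 2n×2n block matrix [[A, B],[0, A + m·B]]. -/
/-- The block matrix `Φ_m(A,B)` whose `(i,j)` block is the `m×m` matrix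
`K_m(a_{i,j}, b_{i,j})` (diagonal entries `a_{i,j} + b_{i,j}`, off-diagonal
entries `b_{i,j}`).  The row/column index `(i, s)` denotes position `s` inside
block row/column `i`. -/
def PhiMat {R : Type*} [CommRing R] (m n : ℕ)
    (A B : Matrix (Fin n) (Fin n) R) :
    Matrix (Fin n × Fin m) (Fin n × Fin m) R :=
  Matrix.of fun p q => if p.2 = q.2 then A p.1 q.1 + B p.1 q.1 else B p.1 q.1

/-- The block diagonal matrix consisting of `m-2` copies of `A` (block
columns `0, …, m-3`) followed by the `2n×2n` block matrix
`[[A, B], [0, A + m·B]]` (block columns `m-2` and `m-1`). -/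
def PhiTarget {R : Type*} [CommRing R] (m n : ℕ)
    (A B : Matrix (Fin n) (Fin n) R) :
    Matrix (Fin n × Fin m) (Fin n × Fin m) R :=
  Matrix.of fun p q =>
    if p.2.val < m - 2 ∨ q.2.val < m - 2 then
      (if p.2 = q.2 then A p.1 q.1 else 0)
    else if p.2.val = m - 2 then
      (if q.2.val = m - 2 then A p.1 q.1 else B p.1 q.1)
    else
      (if q.2.val = m - 2 then 0 else A p.1 q.1 + (m : R) * B p.1 q.1)

open Matrix Kronecker

namespace Matrix

variable {ι R : Type*} [Fintype ι] [DecidableEq ι] [CommRing R]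

/-- A matrix is elementary if it is a product of transvections. -/
def IsElementary (M : Matrix ι ι R) : Prop :=
  ∃ L : List (TransvectionStruct ι R), M = (L.map TransvectionStruct.toMatrix).prod

theorem IsElementary.one : IsElementary (1 : Matrix ι ι R) := ⟨[], by simp⟩

theorem IsElementary.mul {M N : Matrix ι ι R} (hM : IsElementary M) (hN : IsElementary N) :
    IsElementary (M * N) := by
  obtain ⟨L, rfl⟩ := hM
  obtain ⟨L', rfl⟩ := hN
  exact ⟨L ++ L', by simp⟩

theorem isElementary_transvection {i j : ι} (h : i ≠ j) (c : R) :
    IsElementary (transvection i j c) :=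
  ⟨[⟨i, j, h, c⟩], by simp [TransvectionStruct.toMatrix]⟩

/-- If the rows and columns meeting the support of `D` are disjoint, then `1 + D` is elementary. -/
theorem isElementary_one_add (s : Set ι) (D : Matrix ι ι R)
    (hD : ∀ i j, D i j ≠ 0 → i ∉ s ∧ j ∈ s) : IsElementary (1 + D) := by
  classical
  have key : ∀ t : Finset (ι × ι), (∀ x ∈ t, x.1 ∉ s ∧ x.2 ∈ s) →
      IsElementary (1 + ∑ x ∈ t, single x.1 x.2 (D x.1 x.2)) := by
    intro t
    induction t using Finset.induction_on with
    | empty => intro _; simpa using IsElementary.one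
    | insert x t hx ih =>
      intro h
      have hxs := h x (Finset.mem_insert_self x t)
      have ht : ∀ y ∈ t, y.1 ∉ s ∧ y.2 ∈ s := fun y hy => h y (Finset.mem_insert_of_mem hy)
      have hzero : single x.1 x.2 (D x.1 x.2) * ∑ y ∈ t, single y.1 y.2 (D y.1 y.2) = 0 := by
        rw [Finset.mul_sum]
        refine Finset.sum_eq_zero fun y hy => single_mul_single_of_ne _ _ _ _ ?_ _
        intro e
        exact (ht y hy).1 (e ▸ hxs.2)
      have hne : x.1 ≠ x.2 := fun e => hxs.1 (e ▸ hxs.2)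
      have hmul := (isElementary_transvection hne (D x.1 x.2)).mul (ih ht)
      rwa [transvection, mul_add, mul_one, add_mul, one_mul, hzero, add_zero, add_assoc,
        ← Finset.sum_insert (f := fun y : ι × ι => single y.1 y.2 (D y.1 y.2)) hx] at hmul
  have hsum : D = ∑ x : ι × ι with x.1 ∉ s ∧ x.2 ∈ s, single x.1 x.2 (D x.1 x.2) := by
    rw [Finset.sum_filter_of_ne, Fintype.sum_prod_type]
    · exact matrix_eq_sum_single D
    intro x _ hx
    refine hD _ _ fun h => hx ?_
    rw [h, single_zero]
  rw [hsum]
  exact key _ fun x hx => (Finset.mem_filter.mp hx).2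

/-- If `x` and `y` have disjoint supports, then `1 ⊗ (1 + x yᵀ)` is elementary. -/
theorem isElementary_one_kronecker_one_add_vecMulVec {κ : Type*} [Fintype κ] [DecidableEq κ]
    (x y : ι → R) (h : ∀ i, x i = 0 ∨ y i = 0) :
    IsElementary ((1 : Matrix κ κ R) ⊗ₖ (1 + vecMulVec x y)) := by
  rw [kronecker_add, one_kronecker_one]
  refine isElementary_one_add {p | y p.2 ≠ 0} _ fun p q hpq => ?_
  rw [kroneckerMap_apply, vecMulVec_apply] at hpq
  have hxy := right_ne_zero_of_mul hpq
  refine ⟨?_, right_ne_zero_of_mul hxy⟩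
  have := (h p.2).resolve_left (left_ne_zero_of_mul hxy)
  simpa using this

theorem one_add_vecMulVec_mul_one_sub {x y : ι → R} (h : ∀ i, x i = 0 ∨ y i = 0) :
    (1 + vecMulVec x y) * (1 + vecMulVec (-x) y) = 1 := by
  have hdot : y ⬝ᵥ x = 0 := Finset.sum_eq_zero fun i _ => by
    rcases h i with h | h <;> simp [h]
  simp [mul_add, add_mul, vecMulVec_mul_vecMulVec, hdot, neg_vecMulVec]

end Matrix

theorem PhiMat_eq_kronecker {R : Type*} [CommRing R] (m n : ℕ) (A B : Matrix (Fin n) (Fin n) R) :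
    PhiMat m n A B = A ⊗ₖ 1 + B ⊗ₖ vecMulVec 1 1 := by
  ext p q
  by_cases h : p.2 = q.2 <;> simp [PhiMat, one_apply, h]

theorem PhiTarget_eq_kronecker {R : Type*} [CommRing R] (k n : ℕ)
    (A B : Matrix (Fin n) (Fin n) R) :
    PhiTarget (k + 2) n A B = A ⊗ₖ 1 + B ⊗ₖ vecMulVec
      (Pi.single (Fin.last k).castSucc 1 + Pi.single (Fin.last (k + 1)) ((k + 2 : ℕ) : R))
      (Pi.single (Fin.last (k + 1)) 1) := by
  ext ⟨i, s⟩ ⟨j, t⟩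
  simp only [PhiTarget, of_apply, Matrix.add_apply, kroneckerMap_apply, vecMulVec_apply, Pi.add_apply,
    Pi.single_apply, one_apply, Fin.ext_iff, Fin.val_last, Fin.val_castSucc, Nat.add_sub_cancel]
  have hs := s.isLt
  have ht := t.isLt
  split_ifs <;> first | omega | (simp; done) | (simp; ring)

/-- `P = (1 + x yᵀ)(1 + z wᵀ)` conjugates the all-ones matrix to
`(e_k + (k + 2) e_{k + 1}) e_{k + 1}ᵀ`. -/
theorem exists_conj_vecMulVec_one (R : Type*) [CommRing R] (k : ℕ) :
    ∃ x y z w : Fin (k + 2) → R, (∀ i, x i = 0 ∨ y i = 0) ∧ (∀ i, z i = 0 ∨ w i = 0) ∧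
      vecMulVec
        (Pi.single (Fin.last k).castSucc 1 + Pi.single (Fin.last (k + 1)) ((k + 2 : ℕ) : R))
        (Pi.single (Fin.last (k + 1)) 1) * ((1 + vecMulVec x y) * (1 + vecMulVec z w)) =
      ((1 + vecMulVec x y) * (1 + vecMulVec z w)) * vecMulVec 1 1 := by
  let a : Fin (k + 2) → R := fun j => if j.val < k then -1 else 0
  let c : Fin (k + 2) → R := fun j => if j.val < k then 1 else if j.val = k then (k + 1 : R) else 0
  let u : Fin (k + 2) → R := Pi.single (Fin.last k).castSucc 1
  let v : Fin (k + 2) → R := Pi.single (Fin.last (k + 1)) 1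
  have hvc : ∀ i, v i = 0 ∨ c i = 0 := by
    intro i
    simp only [v, c, Pi.single_apply, Fin.ext_iff, Fin.val_last]
    split_ifs <;> first | omega | simp
  have hau : ∀ i, a i = 0 ∨ u i = 0 := by
    intro i
    simp only [u, a, Pi.single_apply, Fin.ext_iff, Fin.val_last, Fin.val_castSucc]
    split_ifs <;> first | omega | simp
  refine ⟨v, c, a, u, hvc, hau, ?_⟩
  have hrow : v ᵥ* ((1 + vecMulVec v c) * (1 + vecMulVec a u)) = 1 := by
    have hvv : v ⬝ᵥ v = 1 := by simp [v]
    have hva : v ⬝ᵥ a = 0 := by simp [v, a]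
    have hca : c ⬝ᵥ a = -k := by
      simp [dotProduct, Fin.sum_univ_castSucc, c, a]
    simp only [← vecMul_vecMul, vecMul_add, vecMul_one, vecMul_vecMulVec, hvv, one_smul,
      add_dotProduct, hva, hca]
    ext i
    simp only [u, v, c, Pi.add_apply, Pi.smul_apply, Pi.one_apply, Pi.single_apply, Fin.ext_iff,
      Fin.val_last, Fin.val_castSucc, smul_eq_mul]
    have hi := i.isLt
    split_ifs <;> first | omega | simp
  have hcol : ((1 + vecMulVec v c) * (1 + vecMulVec a u)) *ᵥ 1 =
      u + Pi.single (Fin.last (k + 1)) ((k + 2 : ℕ) : R) := by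
    have ha : (1 + vecMulVec a u) *ᵥ 1 = u + v := by
      ext i
      have hi := i.isLt
      simp only [add_mulVec, one_mulVec, vecMulVec_mulVec, Pi.add_apply]
      simp only [u, v, a, Pi.smul_apply, single_one_dotProduct, Pi.one_apply, Pi.single_apply,
        Fin.ext_iff, Fin.val_last, Fin.val_castSucc]
      split_ifs <;> first | omega | simp
    have hcu : c ⬝ᵥ u = k + 1 := by simp [u, c]
    have hcv : c ⬝ᵥ v = 0 := by simp [v, c]
    rw [← mulVec_mulVec, ha]
    simp only [add_mulVec, one_mulVec, vecMulVec_mulVec, dotProduct_add, hcu, hcv]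
    ext i
    simp only [v, Pi.add_apply, Pi.smul_apply, Pi.single_apply]
    split_ifs <;> simp
    ring
  rw [vecMulVec_mul, mul_vecMulVec, hrow, hcol]

/-- `Φ_m(A,B)` is elementary equivalent (via products of transvections, i.e.
elementary matrices) to `A ⊕ ⋯ ⊕ A ⊕ [[A, B], [0, A + m·B]]` with `m-2`
copies of `A`. -/
theorem PhiMat_elementary_equiv {R : Type*} [CommRing R] (m n : ℕ)
    (hm : 2 ≤ m) (hn : 2 ≤ n) (A B : Matrix (Fin n) (Fin n) R) :
    ∃ L₁ L₂ : List (Matrix.TransvectionStruct (Fin n × Fin m) R),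
      PhiTarget m n A B =
        (L₁.map Matrix.TransvectionStruct.toMatrix).prod * PhiMat m n A B *
          (L₂.map Matrix.TransvectionStruct.toMatrix).prod := by
  obtain ⟨k, rfl⟩ : ∃ k, m = k + 2 := ⟨m - 2, by omega⟩
  obtain ⟨x, y, z, w, hxy, hzw, h⟩ := exists_conj_vecMulVec_one R k
  have hxy' : ∀ i, (-x) i = 0 ∨ y i = 0 := fun i => by simpa using hxy i
  have hzw' : ∀ i, (-z) i = 0 ∨ w i = 0 := fun i => by simpa using hzw i
  obtain ⟨L₁, hL₁⟩ := (isElementary_one_kronecker_one_add_vecMulVec (κ := Fin n) x y hxy).mul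
    (isElementary_one_kronecker_one_add_vecMulVec z w hzw)
  obtain ⟨L₂, hL₂⟩ := (isElementary_one_kronecker_one_add_vecMulVec (κ := Fin n) (-z) w hzw').mul
    (isElementary_one_kronecker_one_add_vecMulVec (-x) y hxy')
  have hinv : ((1 + vecMulVec x y) * (1 + vecMulVec z w)) *
      ((1 + vecMulVec (-z) w) * (1 + vecMulVec (-x) y)) = 1 := by
    rw [mul_assoc, ← mul_assoc (1 + vecMulVec z w), one_add_vecMulVec_mul_one_sub hzw, one_mul,
      one_add_vecMulVec_mul_one_sub hxy]
  refine ⟨L₁, L₂, ?_⟩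
  rw [← hL₁, ← hL₂, ← mul_kronecker_mul, ← mul_kronecker_mul, PhiMat_eq_kronecker,
    PhiTarget_eq_kronecker, mul_add, add_mul]
  simp only [← mul_kronecker_mul, one_mul, mul_one]
  rw [hinv, ← h, mul_assoc (vecMulVec _ _), hinv, mul_one]
end

section
/- Let 𝔸 be a principal ideal domain, let a, b ∈ 𝔸 not both zero, let r = gcd(a,b), and write a = r·a', b = r·b'. Then for all n ≥ 2 the matrix K_n(a,b) is unitarily equivalent to the n×n diagonal matrix diag(r, a, a, …, a, a'·(a+n·b)) whose first diagonal entry is r, whose next n−2 diagonal entries are a, and whose last diagonal entry is a'·(a+n·b). -/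
/-- Equivalence of square matrices under left and right multiplication by matrices of
determinant one. -/
def UnitarilyEquiv {A ι : Type*} [CommRing A] [Fintype ι] [DecidableEq ι]
    (M N : Matrix ι ι A) : Prop :=
  ∃ P Q : Matrix ι ι A, P.det = 1 ∧ Q.det = 1 ∧ N = P * M * Q

namespace UnitarilyEquiv

variable {A ι κ : Type*} [CommRing A] [Fintype ι] [DecidableEq ι] [Fintype κ] [DecidableEq κ]

theorem trans {M N R : Matrix ι ι A} (h : UnitarilyEquiv M N) (h' : UnitarilyEquiv N R) :
    UnitarilyEquiv M R := by
  obtain ⟨P, Q, hP, hQ, rfl⟩ := h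
  obtain ⟨P', Q', hP', hQ', rfl⟩ := h'
  exact ⟨P' * P, Q * Q', by simp [hP, hP'], by simp [hQ, hQ'], by simp only [Matrix.mul_assoc]⟩

theorem of_submatrix (e : κ ≃ ι) {M N : Matrix ι ι A}
    (h : UnitarilyEquiv (M.submatrix e e) (N.submatrix e e)) : UnitarilyEquiv M N := by
  obtain ⟨P, Q, hP, hQ, h⟩ := h
  refine ⟨P.submatrix e.symm e.symm, Q.submatrix e.symm e.symm, by simpa using hP,
    by simpa using hQ, ?_⟩
  have h' := congrArg (fun X => X.submatrix e.symm e.symm) h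
  simpa [← Matrix.submatrix_mul_equiv _ _ _ e.symm] using h'

end UnitarilyEquiv

namespace Matrix

variable {A : Type*} [CommRing A]

/-- The upper triangular matrix `!![x, y; 0, z]` is equivalent to a diagonal one as soon as `x`, `y`
and `z` have a common divisor `r` for which the cofactors of `y` and `z` satisfy a Bézout identity. -/
theorem unitarilyEquiv_fin_two (r a' b' s t c : A) (h : a' * s + b' * t = 1) :
    UnitarilyEquiv !![r * c, r * b'; 0, r * a'] !![r, 0; 0, a' * (r * c)] := by
  refine ⟨!![t, s; -a', b'], !![0, -1; 1, t * c], ?_, ?_, ?_⟩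
  · rw [det_fin_two_of]; linear_combination h
  · simp [det_fin_two_of]
  · ext i j
    fin_cases i <;> fin_cases j <;> simp [Matrix.mul_apply, Fin.sum_univ_two]
    · linear_combination (-r) * h
    · linear_combination (-(t * r * c)) * h
    all_goals ring

variable {ι κ : Type*} [Fintype ι] [DecidableEq ι] [Fintype κ] [DecidableEq κ]

theorem unitarilyEquiv_fromBlocks {M N : Matrix ι ι A} (h : UnitarilyEquiv M N)
    (D : Matrix κ κ A) : UnitarilyEquiv (fromBlocks M 0 0 D) (fromBlocks N 0 0 D) := by
  obtain ⟨P, Q, hP, hQ, rfl⟩ := h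
  exact ⟨fromBlocks P 0 0 1, fromBlocks Q 0 0 1, by simp [hP], by simp [hQ],
    by simp [fromBlocks_multiply]⟩

/-- Row and column operations split `a·I + b·J`, with rows and columns indexed by `Fin 2 ⊕ κ`, into
a triangular `2 × 2` block and a scalar block. -/
theorem unitarilyEquiv_scalar_add_const (a b : A) :
    UnitarilyEquiv
      (of fun i j : Fin 2 ⊕ κ => if i = j then a + b else b)
      (fromBlocks !![a + (Fintype.card κ + 2 : A) * b, b; 0, a] 0 0 (a • (1 : Matrix κ κ A))) := by
  let E : Matrix κ (Fin 2) A := of fun _ => ![1, 0]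
  let F : Matrix (Fin 2) κ A := of ![0, 1]
  refine ⟨fromBlocks 1 F 0 1 * (fromBlocks !![1, 0; -1, 1] 0 0 1 * fromBlocks 1 0 (-E) 1),
    fromBlocks 1 0 E 1 * (fromBlocks !![1, 0; 1, 1] 0 0 1 * fromBlocks 1 (-F) 0 1),
    by simp [det_fin_two_of], by simp [det_fin_two_of], ?_⟩
  have hK : (of fun i j : Fin 2 ⊕ κ => if i = j then a + b else b) =
      fromBlocks !![a + b, b; b, a + b] (of fun _ _ => b) (of fun _ _ => b)
        (a • (1 : Matrix κ κ A) + of fun _ _ => b) := by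
    ext (i | i) (j | j)
    · fin_cases i <;> fin_cases j <;> simp
    · simp
    · simp
    · by_cases h : i = j <;> simp [h]
  have h1 : fromBlocks 1 0 (-E) 1 * (of fun i j : Fin 2 ⊕ κ => if i = j then a + b else b) =
      fromBlocks !![a + b, b; b, a + b] (of fun _ _ => b) (of fun _ => ![-a, 0])
        (a • (1 : Matrix κ κ A)) := by
    rw [hK, fromBlocks_multiply, fromBlocks_inj]
    refine ⟨by simp, by simp, ?_, ?_⟩ <;> ext i j
    · fin_cases j <;> simp [E, Matrix.mul_apply, Fin.sum_univ_two]
    · simp [E, Matrix.mul_apply, Fin.sum_univ_two]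
  have h2 : fromBlocks !![a + b, b; b, a + b] (of fun _ _ => b) (of fun _ => ![-a, 0])
        (a • (1 : Matrix κ κ A)) * fromBlocks 1 0 E 1 =
      fromBlocks !![a + b + Fintype.card κ * b, b; b + Fintype.card κ * b, a + b]
        (of fun _ _ => b) 0 (a • (1 : Matrix κ κ A)) := by
    rw [fromBlocks_multiply, fromBlocks_inj]
    refine ⟨?_, by simp, ?_, by simp⟩ <;> ext i j
    · fin_cases i <;> fin_cases j <;> simp [E, Matrix.mul_apply]
    · fin_cases j <;> simp [E]
  have h3 : fromBlocks !![1, 0; -1, 1] 0 0 1 *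
      fromBlocks !![a + b + Fintype.card κ * b, b; b + Fintype.card κ * b, a + b]
        (of fun _ _ => b) 0 (a • (1 : Matrix κ κ A)) * fromBlocks !![1, 0; 1, 1] 0 0 1 =
      fromBlocks !![a + (Fintype.card κ + 2 : A) * b, b; 0, a] (of ![fun _ => b, 0]) 0
        (a • (1 : Matrix κ κ A)) := by
    rw [fromBlocks_multiply, fromBlocks_multiply, fromBlocks_inj]
    refine ⟨?_, ?_, by simp, by simp⟩ <;> ext i j
    · fin_cases i <;> fin_cases j <;> simp <;> ring
    · fin_cases i <;> simp [vecHead, vecTail]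
  have h4 : fromBlocks 1 F 0 1 *
      fromBlocks !![a + (Fintype.card κ + 2 : A) * b, b; 0, a] (of ![fun _ => b, 0]) 0
        (a • (1 : Matrix κ κ A)) * fromBlocks 1 (-F) 0 1 =
      fromBlocks !![a + (Fintype.card κ + 2 : A) * b, b; 0, a] 0 0 (a • (1 : Matrix κ κ A)) := by
    rw [fromBlocks_multiply, fromBlocks_multiply, fromBlocks_inj]
    refine ⟨by simp, ?_, by simp, by simp⟩
    ext i j
    fin_cases i <;> simp [F]
  rw [← h4, ← h3, ← h2, ← h1]
  simp only [Matrix.mul_assoc]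

end Matrix

/-- The indexing of `Fin (m + 2)` that separates the two endpoints from the interior points. -/
noncomputable def finEndpointsEquiv (m : ℕ) : Fin 2 ⊕ Fin m ≃ Fin (m + 2) :=
  Equiv.ofBijective (Sum.elim ![0, Fin.last (m + 1)] fun i => i.succ.castSucc) <| by
    rw [Fintype.bijective_iff_injective_and_card]
    refine ⟨?_, by simp [add_comm]⟩
    rintro (i | i) (j | j) h
    · fin_cases i <;> fin_cases j <;> simp_all [Fin.ext_iff]
    · fin_cases i
      · simp_all [Fin.ext_iff]
      · simp_all [Fin.ext_iff]
        omega
    · fin_cases j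
      · simp_all [Fin.ext_iff]
      · simp_all [Fin.ext_iff]
        omega
    · simp_all [Fin.ext_iff]

/-- Over a principal ideal domain, if `a, b` are not both zero, `r` is a
greatest common divisor of `a` and `b`, `a = r·a'`, `b = r·b'`, then for all
`n ≥ 2` the matrix `K_n(a,b)` is unitarily equivalent to
`diag(r, a, …, a, a'·(a + n·b))`. -/
theorem Kmat_unitarily_equiv_diagonal_pid {A : Type*} [CommRing A] [IsDomain A]
    [IsPrincipalIdealRing A] (a b r a' b' : A)
    (hab : ¬(a = 0 ∧ b = 0))
    (ha : a = r * a') (hb : b = r * b')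
    (hgcd : ∀ d : A, d ∣ a → d ∣ b → d ∣ r)
    (n : ℕ) (hn : 2 ≤ n) :
    ∃ P Q : Matrix (Fin n) (Fin n) A, P.det = 1 ∧ Q.det = 1 ∧
      Matrix.diagonal
          (fun i : Fin n =>
            if i.val = 0 then r
            else if i.val = n - 1 then a' * (a + (n : A) * b)
            else a)
        = P * Kmat n a b * Q := by
  have hr : r ≠ 0 := by
    rintro rfl
    exact hab ⟨by simpa using ha, by simpa using hb⟩
  obtain ⟨s, t, hst⟩ : ∃ s t, a' * s + b' * t = 1 := by
    obtain ⟨g, hg⟩ := IsPrincipalIdealRing.principal (Ideal.span {a, b})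
    replace hg : Ideal.span {a, b} = Ideal.span {g} := hg
    have hga : g ∣ a := by
      rw [← Ideal.mem_span_singleton, ← hg]; exact Ideal.subset_span (by simp)
    have hgb : g ∣ b := by
      rw [← Ideal.mem_span_singleton, ← hg]; exact Ideal.subset_span (by simp)
    have hmem : r ∈ Ideal.span {a, b} := by
      rw [hg, Ideal.mem_span_singleton]; exact hgcd g hga hgb
    obtain ⟨s, t, h⟩ := Ideal.mem_span_pair.mp hmem
    exact ⟨s, t, mul_left_cancel₀ hr (by linear_combination h - s * ha - t * hb)⟩
  obtain ⟨m, rfl⟩ := Nat.exists_eq_add_of_le' hn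
  refine UnitarilyEquiv.of_submatrix (finEndpointsEquiv m) ?_
  have hK : (Kmat (m + 2) a b).submatrix (finEndpointsEquiv m) (finEndpointsEquiv m) =
      Matrix.of fun i j => if i = j then a + b else b := by
    ext i j
    simp [Kmat]
  rw [hK]
  have h2 := Matrix.unitarilyEquiv_fin_two r a' b' s t (a' + (m + 2 : A) * b') hst
  have hc : r * (a' + (m + 2 : A) * b') = a + (m + 2 : A) * b := by rw [ha, hb]; ring
  rw [hc, ← ha, ← hb] at h2
  have h := (Matrix.unitarilyEquiv_scalar_add_const (κ := Fin m) a b).trans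
    (Matrix.unitarilyEquiv_fromBlocks (by simpa using h2) _)
  convert h using 1
  ext (i | i) (j | j)
  · fin_cases i <;> fin_cases j <;> simp [finEndpointsEquiv]
  · fin_cases i <;> simp
  · fin_cases j <;> simp
  · simp [finEndpointsEquiv, Matrix.diagonal_apply, Matrix.one_apply, i.isLt.ne]
end

section
/- Let m ≥ 0, l ≥ 1, n ≥ 4, and r = gcd(l, m). The reduced Laplacian of the m-cone of the complete graph K_n with all edges of multiplicity l is the n×n integer matrix K_n(m+n·l, −l) with diagonal entries m+(n−1)·l and off-diagonal entries −l. Its cokernel, the critical group K(c_m(K_n(l))) = ℤⁿ / K_n(m+n·l, −l)ᵀ ℤⁿ, is isomorphic to ℤ_r ⊕ (ℤ_{m+n·l})^{n−2} ⊕ ℤ_{m·(m+n·l)/r}. -/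
open Matrix

theorem Kmat_transpose_mulVec {n : ℕ} (a b : ℤ) (x : Fin n → ℤ) (i : Fin n) :
    ((Kmat n a b)ᵀ *ᵥ x) i = a * x i + b * ∑ j, x j := by
  have h (j : Fin n) : (Kmat n a b)ᵀ i j * x j = (if j = i then a * x j else 0) + b * x j := by
    simp only [Kmat, Matrix.transpose_apply, Matrix.of_apply]
    split_ifs <;> ring
  simp only [Matrix.mulVec, dotProduct, h, Finset.sum_add_distrib, ← Finset.mul_sum]
  simp

/-- The invariant-factor map on `ℤ^(k+2)`: with `p = y 0` and `q = ∑ i, (y i - y 0)`, send `y` to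
`α p + β q`, the differences `y i - y 0` for `2 ≤ i`, and `γ p + δ q`. -/
def coneHom (k r c e : ℕ) (α β γ δ : ℤ) :
    (Fin (k + 2) → ℤ) →+ ZMod r × (Fin k → ZMod c) × ZMod e :=
  AddMonoidHom.mk'
    (fun y => (((α * y 0 + β * ∑ i, (y i - y 0) : ℤ) : ZMod r),
      (fun i => ((y i.succ.succ - y 0 : ℤ) : ZMod c)),
      ((γ * y 0 + δ * ∑ i, (y i - y 0) : ℤ) : ZMod e)))
    (by
      intro y z
      ext i
      · simp only [Pi.add_apply, Prod.fst_add, ← Int.cast_add]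
        congr 1
        simp only [Finset.sum_sub_distrib, Finset.sum_add_distrib]
        ring
      · simp only [Pi.add_apply, Prod.fst_add, Prod.snd_add, ← Int.cast_add]
        congr 1
        ring
      · simp only [Pi.add_apply, Prod.snd_add, ← Int.cast_add]
        congr 1
        simp only [Finset.sum_sub_distrib, Finset.sum_add_distrib]
        ring)

theorem coneHom_apply (k r c e : ℕ) (α β γ δ : ℤ) (y : Fin (k + 2) → ℤ) :
    coneHom k r c e α β γ δ y = (((α * y 0 + β * ∑ i, (y i - y 0) : ℤ) : ZMod r),
      (fun i => ((y i.succ.succ - y 0 : ℤ) : ZMod c)),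
      ((γ * y 0 + δ * ∑ i, (y i - y 0) : ℤ) : ZMod e)) := rfl

theorem coneHom_surjective (k r c e : ℕ) {α β γ δ : ℤ} (h : α * δ - β * γ = 1) :
    Function.Surjective (coneHom k r c e α β γ δ) := by
  rintro ⟨a, w, b⟩
  obtain ⟨a, rfl⟩ := ZMod.intCast_surjective a
  obtain ⟨b, rfl⟩ := ZMod.intCast_surjective b
  choose v hv using fun i => ZMod.intCast_surjective (w i)
  set p := δ * a - β * b with hp
  set q := -γ * a + α * b with hq
  refine ⟨Fin.cons p (Fin.cons (p + q - ∑ i, v i) fun i => p + v i), ?_⟩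
  rw [coneHom_apply]
  simp only [Fin.sum_univ_succ, Fin.cons_zero, Fin.cons_succ, add_sub_cancel_left, Prod.mk.injEq]
  refine ⟨?_, funext fun i => hv i, ?_⟩
  · congr 1
    linear_combination α * hp + β * hq + a * h
  · congr 1
    linear_combination γ * hp + δ * hq + b * h

theorem coneHom_eq_zero_iff (k r l' m' c' : ℕ) {α β : ℤ} (hc : c' = m' + (k + 2) * l')
    (h : α * l' - β * c' = 1) (y : Fin (k + 2) → ℤ) :
    coneHom k r (r * c') (r * (m' * c')) α β c' l' y = 0 ↔
      ∃ x : Fin (k + 2) → ℤ, ∀ i, (r * c' : ℤ) * x i - r * l' * ∑ j, x j = y i := by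
  have hc' : (c' : ℤ) = m' + (k + 2) * l' := by exact_mod_cast hc
  rw [coneHom_apply]
  simp only [Prod.mk_eq_zero, funext_iff, Pi.zero_apply, ZMod.intCast_zmod_eq_zero_iff_dvd]
  push_cast
  constructor
  · rintro ⟨⟨A, hA⟩, hw, ⟨B, hB⟩⟩
    choose w hw using hw
    set q := ∑ i, (y i - y 0) with hq
    have hp0 : y 0 = l' * (r * A) - β * (r * (m' * c') * B) := by
      linear_combination l' * hA - β * hB - y 0 * h
    have hq0 : q = -c' * (r * A) + α * (r * (m' * c') * B) := by
      linear_combination -c' * hA + α * hB - q * h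
    set D := -A + α * m' * B with hD
    have hsum : q = (y 1 - y 0) + r * c' * ∑ i, w i := by
      rw [hq, Fin.sum_univ_succ, Fin.sum_univ_succ, Finset.mul_sum]
      simp only [hw, sub_self, zero_add, Fin.succ_zero_eq_one]
    refine ⟨Fin.cons B (Fin.cons (B + D - ∑ i, w i) fun i => B + w i), ?_⟩
    have hs : ∑ j, (Fin.cons B (Fin.cons (B + D - ∑ i, w i) fun i => B + w i) :
        Fin (k + 2) → ℤ) j = (k + 2) * B + D := by
      simp only [Fin.sum_univ_succ, Fin.cons_zero, Fin.cons_succ, Finset.sum_add_distrib,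
        Finset.sum_const, Finset.card_univ, Fintype.card_fin, nsmul_eq_mul]
      ring
    rw [hs]
    have h0 : (r * c' : ℤ) * B - r * l' * ((k + 2) * B + D) = y 0 := by
      linear_combination -hp0 - r * l' * hD + r * B * hc' - r * m' * B * h
    refine Fin.cases ?_ (Fin.cases ?_ fun i => ?_)
    · simpa using h0
    · rw [Fin.cons_succ, Fin.cons_zero, Fin.succ_zero_eq_one]
      linear_combination h0 + hsum - hq0 + r * c' * hD
    · simp only [Fin.cons_succ]
      linear_combination h0 - hw i
  · rintro ⟨x, hx⟩
    have hq : ∑ i, (y i - y 0) = r * c' * (∑ i, x i - (k + 2) * x 0) := by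
      simp only [← hx, sub_sub_sub_cancel_right, Finset.sum_sub_distrib, ← Finset.mul_sum,
        Finset.sum_const, Finset.card_univ, Fintype.card_fin, nsmul_eq_mul]
      push_cast
      ring
    rw [hq, ← hx 0]
    refine ⟨⟨α * (c' * x 0 - l' * ∑ i, x i) + β * c' * (∑ i, x i - (k + 2) * x 0), by ring⟩,
      fun i => ⟨x i.succ.succ - x 0, ?_⟩, ⟨x 0, ?_⟩⟩
    · rw [← hx]
      ring
    · linear_combination r * c' * x 0 * hc'

/-- The critical group of the `m`-cone of `K_n(l)`, i.e. the cokernel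
`ℤⁿ / K_n(m+n·l, -l)ᵀ ℤⁿ`, is isomorphic to
`ℤ_r ⊕ (ℤ_{m+n·l})^(n-2) ⊕ ℤ_{m·(m+n·l)/r}` where `r = gcd(l, m)`. -/
theorem criticalGroup_cone_complete (m l n : ℕ) (hl : 1 ≤ l) (hn : 4 ≤ n) :
    Nonempty
      (((Fin n → ℤ) ⧸
          LinearMap.range (Matrix.toLin' (Kmat n ((m : ℤ) + n * l) (-(l : ℤ)))ᵀ)) ≃+
        (ZMod (Nat.gcd l m) × (Fin (n - 2) → ZMod (m + n * l)) ×
          ZMod (m * (m + n * l) / Nat.gcd l m))) := by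
  obtain ⟨k, rfl⟩ : ∃ k, n = k + 2 := ⟨n - 2, by omega⟩
  obtain ⟨l', m', hco, hl', hm'⟩ := Nat.exists_coprime l m
  have hr : 0 < Nat.gcd l m := Nat.gcd_pos_of_pos_left _ hl
  generalize Nat.gcd l m = r at *
  subst hl' hm'
  set c' := m' + (k + 2) * l' with hc
  have hcr : m' * r + (k + 2) * (l' * r) = r * c' := by rw [hc]; ring
  have he : m' * r * (r * c') / r = r * (m' * c') :=
    Nat.div_eq_of_eq_mul_left hr (by ring)
  have hk : k + 2 - 2 = k := rfl
  rw [hcr, he, hk]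
  obtain ⟨u, v, huv⟩ := Nat.isCoprime_iff_coprime.2 hco
  have hdet : (u - (k + 2) * v) * l' - (-v) * (c' : ℤ) = 1 := by
    rw [hc]
    push_cast
    linear_combination huv
  have hker : (LinearMap.range (Matrix.toLin' (Kmat (k + 2)
      (((m' * r : ℕ) : ℤ) + (k + 2 : ℕ) * (l' * r : ℕ)) (-((l' * r : ℕ) : ℤ)))ᵀ)).toAddSubgroup =
      (coneHom k r (r * c') (r * (m' * c')) (u - (k + 2) * v) (-v) c' l').ker := by
    ext y
    rw [AddMonoidHom.mem_ker, coneHom_eq_zero_iff k r l' m' c' hc hdet, Submodule.mem_toAddSubgroup,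
      LinearMap.mem_range]
    refine exists_congr fun x => ?_
    rw [Matrix.toLin'_apply, funext_iff]
    refine forall_congr' fun i => ?_
    rw [Kmat_transpose_mulVec, hc]
    push_cast
    ring_nf
  exact ⟨(QuotientAddGroup.quotientAddEquivOfEq hker).trans
    (QuotientAddGroup.quotientKerEquivOfSurjective _ (coneHom_surjective k r _ _ hdet))⟩
end

section
/- Let m ≥ 0, l ≥ 1, n ≥ 2, and r = gcd(l, m). The reduced Laplacian of the m-cone of the path P_n with all edges of multiplicity l is the n×n integer matrix P_n(m+2l, −l), the tridiagonal matrix with diagonal entries (m+l, m+2l, …, m+2l, m+l) and off-diagonal entries −l in positions (i,j) with |i−j| = 1. Let t be the integer with r^{n−1}·t = f_{n−1}(m+2l, −l) (this divisibility holds). Then the critical group K(c_m(P_n(l))) = ℤⁿ / P_n(m+2l, −l)ᵀ ℤⁿ is isomorphic to (ℤ_r)^{n−1} ⊕ ℤ_{m·t}. -/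
open Matrix

section Quotient

/-- If `N` consists of the `r`-fold multiples of the vectors on which a surjective functional `φ`
is divisible by `d`, then the quotient by `N` is `(ℤ/r)ⁿ⁻¹ × ℤ/(r * d)`. -/
theorem nonempty_quotient_addEquiv_of_functional {n : ℕ} (φ : (Fin n → ℤ) →ₗ[ℤ] ℤ)
    {v : Fin n → ℤ} (hv : φ v = 1) (r : ℕ) (d : ℤ) (N : Submodule ℤ (Fin n → ℤ))
    (hN : ∀ x, x ∈ N ↔ ∃ y, d ∣ φ y ∧ x = (r : ℤ) • y) :
    Nonempty (((Fin n → ℤ) ⧸ N) ≃+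
      ((Fin (n - 1) → ZMod r) × ZMod ((r * d).natAbs))) := by
  have hsurj : Function.Surjective φ := fun c => ⟨c • v, by simp [-zsmul_eq_mul, hv]⟩
  have hrank : Module.finrank ℤ (LinearMap.ker φ) = n - 1 := by
    have h := Submodule.finrank_quotient_add_finrank (LinearMap.ker φ)
    rw [(φ.quotKerEquivOfSurjective hsurj).finrank_eq] at h
    simp only [Module.finrank_self, Module.finrank_fin_fun] at h
    omega
  let B := (Module.finBasisOfFinrankEq ℤ (LinearMap.ker φ) hrank).equivFun
  let π : (Fin n → ℤ) →ₗ[ℤ] LinearMap.ker φ :=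
    (LinearMap.id - φ.smulRight v).codRestrict _ fun x => by simp [-zsmul_eq_mul, hv]
  have hπ : ∀ x, (π x : Fin n → ℤ) = x - φ x • v := fun x => rfl
  let Ψ : (Fin n → ℤ) →ₗ[ℤ] (Fin (n - 1) → ZMod r) × ZMod ((r * d).natAbs) :=
    LinearMap.prod
      (((Int.castAddHom (ZMod r)).toIntLinearMap.compLeft (Fin (n - 1))) ∘ₗ B.toLinearMap ∘ₗ π)
      ((Int.castAddHom (ZMod ((r * d).natAbs))).toIntLinearMap ∘ₗ φ)
  have hΨ : ∀ x, Ψ x = (fun i => ((B (π x) i : ℤ) : ZMod r), ((φ x : ℤ) : ZMod _)) :=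
    fun x => rfl
  have hker : LinearMap.ker Ψ = N := by
    ext x
    rw [LinearMap.mem_ker, hΨ, Prod.mk_eq_zero, hN, funext_iff]
    simp only [Pi.zero_apply, ZMod.intCast_zmod_eq_zero_iff_dvd,
      Int.natCast_natAbs, abs_dvd]
    constructor
    · rintro ⟨h₁, c, hc⟩
      choose w hw using h₁
      refine ⟨B.symm w + (d * c) • v, ?_, ?_⟩
      · simp [-zsmul_eq_mul, hv]
      · have hx : π x = (r : ℤ) • B.symm w := by
          apply B.injective
          ext i
          simp [hw]
        have := hπ x
        rw [hx, hc] at this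
        rw [smul_add, smul_smul, ← mul_assoc, ← Submodule.coe_smul, this]
        simp
    · rintro ⟨y, hy, rfl⟩
      rw [map_smul, map_smul, map_smul]
      exact ⟨fun i => dvd_mul_right _ _, mul_dvd_mul_left (r : ℤ) hy⟩
  have hΨsurj : Function.Surjective Ψ := by
    rintro ⟨w, c⟩
    choose w' hw' using fun i => ZMod.intCast_surjective (w i)
    obtain ⟨c', rfl⟩ := ZMod.intCast_surjective c
    have hφ : φ (B.symm w' + c' • v) = c' := by simp [-zsmul_eq_mul, hv]
    refine ⟨B.symm w' + c' • v, ?_⟩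
    have hx : π (B.symm w' + c' • v) = B.symm w' := by
      apply Subtype.ext
      rw [hπ, hφ]
      simp
    rw [hΨ, hφ, hx]
    simp [hw']
  exact ⟨((Submodule.quotEquivOfEq _ _ hker.symm).trans
    (Ψ.quotKerEquivOfSurjective hΨsurj)).toAddEquiv⟩

end Quotient

section Tridiagonal

theorem sum_Pmat_mul {A : Type*} [CommRing A] {n : ℕ} (a b : A) (h : ℕ → A) (i : Fin n) :
    ∑ j : Fin n, Pmat n a b i j * h j =
      (if i.val = 0 ∨ i.val = n - 1 then a + b else a) * h i
        + (if 0 < i.val then b * h (i - 1) else 0)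
        + (if i.val + 1 < n then b * h (i + 1) else 0) := by
  have hterm : ∀ j : Fin n, Pmat n a b i j * h j =
      (if j.val = i.val then (if i.val = 0 ∨ i.val = n - 1 then a + b else a) * h i else 0)
        + (if j.val = i.val - 1 then (if 0 < i.val then b * h (i - 1) else 0) else 0)
        + (if j.val = i.val + 1 then b * h (i + 1) else 0) := by
    intro j
    simp only [Pmat, Matrix.of_apply, Fin.ext_iff]
    by_cases h₁ : i.val = j.val
    · obtain rfl : i = j := Fin.ext h₁
      have h₂ : i.val = i.val - 1 → ¬ 0 < i.val := by omega
      by_cases h₃ : i.val = i.val - 1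
      · simp only [if_pos h₃, if_neg (h₂ h₃)]
        simp
      · simp [h₃]
    · grind
  rw [Finset.sum_congr rfl fun j _ => hterm j, Finset.sum_add_distrib, Finset.sum_add_distrib]
  have hi := i.isLt
  rw [Fin.sum_univ_eq_sum_range (fun j => if j = i.val then _ else 0),
    Fin.sum_univ_eq_sum_range (fun j => if j = i.val - 1 then _ else 0),
    Fin.sum_univ_eq_sum_range (fun j => if j = i.val + 1 then b * h (i + 1) else 0),
    Finset.sum_ite_eq', Finset.sum_ite_eq', Finset.sum_ite_eq']
  have : i.val - 1 < n := by omega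
  simp [this]

theorem Pmat_mul_mul {A : Type*} [CommRing A] (n : ℕ) (c a b : A) :
    Pmat n (c * a) (c * b) = c • Pmat n a b := by
  ext i j
  simp only [Pmat, Matrix.smul_apply, Matrix.of_apply, smul_eq_mul]
  split_ifs <;> ring

theorem fseq_mul_mul {A : Type*} [CommRing A] (c x y : A) :
    ∀ n, fseq (c * x) (c * y) n = c ^ n * fseq x y n
  | 0 => by simp [fseq]
  | 1 => by simp [fseq]
  | n + 2 => by
    rw [fseq, fseq, fseq_mul_mul c x y (n + 1), fseq_mul_mul c x y n]
    ring

/-- The sequence `f_n + b f_{n-1}` of leading principal `n × n` minors of `Pmat N a b`, `n < N`. -/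
def pathMinor {A : Type*} [CommRing A] (a b : A) : ℕ → A
  | 0 => 1
  | n + 1 => fseq a b (n + 1) + b * fseq a b n

theorem pathMinor_add_two {A : Type*} [CommRing A] (a b : A) (n : ℕ) :
    pathMinor a b (n + 2) = a * pathMinor a b (n + 1) - b ^ 2 * pathMinor a b n := by
  cases n <;> simp only [pathMinor, fseq] <;> ring

theorem pathMinor_last {A : Type*} [CommRing A] (a b : A) (n : ℕ) :
    (a + b) * pathMinor a b (n + 1) - b ^ 2 * pathMinor a b n
      = (a + 2 * b) * fseq a b (n + 1) := by
  cases n <;> simp only [pathMinor, fseq] <;> ring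

theorem isCoprime_pathMinor {l m : ℤ} (h : IsCoprime l m) :
    ∀ n, IsCoprime l (pathMinor (m + 2 * l) (-l) n)
  | 0 => isCoprime_one_right
  | 1 => by
    have : pathMinor (m + 2 * l) (-l) 1 = m + l * 1 := by simp only [pathMinor, fseq]; ring
    rw [this]
    exact h.add_mul_left_right 1
  | n + 2 => by
    have : pathMinor (m + 2 * l) (-l) (n + 2) = m * pathMinor (m + 2 * l) (-l) (n + 1)
        + l * (2 * pathMinor (m + 2 * l) (-l) (n + 1) - l * pathMinor (m + 2 * l) (-l) n) := by
      rw [pathMinor_add_two]; ring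
    rw [this]
    exact (h.mul_right (isCoprime_pathMinor h (n + 1))).add_mul_left_right _

/-- The functional that takes `x` to `∑ j, lⁿ⁻¹⁻ʲ g_j x_j`, with `g = pathMinor (m + 2 * l) (-l)`.
-/
def pathFunctional (n : ℕ) (m l : ℤ) : (Fin n → ℤ) →ₗ[ℤ] ℤ :=
  Fintype.linearCombination ℤ
    fun j : Fin n => l ^ (n - 1 - j.val) * pathMinor (m + 2 * l) (-l) j

theorem pathFunctional_apply (n : ℕ) (m l : ℤ) (x : Fin n → ℤ) :
    pathFunctional n m l x =
      ∑ j, x j * (l ^ (n - 1 - j.val) * pathMinor (m + 2 * l) (-l) j) := rfl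

theorem pathFunctional_single (n : ℕ) (m l : ℤ) (i : Fin n) (c : ℤ) :
    pathFunctional n m l (Pi.single i c) =
      c * (l ^ (n - 1 - i.val) * pathMinor (m + 2 * l) (-l) i) := by
  simp [pathFunctional]

theorem pathFunctional_row_of_lt {n : ℕ} (m l : ℤ) (i : Fin n) (hi : i.val + 1 < n) :
    pathFunctional n m l (Pmat n (m + 2 * l) (-l) i) = 0 := by
  rw [pathFunctional_apply,
    sum_Pmat_mul _ _ (fun j => l ^ (n - 1 - j) * pathMinor (m + 2 * l) (-l) j)]
  obtain ⟨k, hk⟩ := i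
  obtain ⟨e, rfl⟩ : ∃ e, n = k + 2 + e := ⟨n - (k + 2), by simp only at hi; omega⟩
  have h₁ : k + 2 + e - 1 - (k + 1) = e := by omega
  have h₂ : k + 2 + e - 1 - k = e + 1 := by omega
  have h₃ : k + 1 < k + 2 + e := by omega
  have h₄ : k ≠ k + 2 + e - 1 := by omega
  cases k with
  | zero =>
    simp only [h₁, h₂, h₃, true_or, if_true, lt_irrefl, if_false]
    simp only [pathMinor, fseq]
    ring
  | succ k =>
    have h₅ : k + 1 + 2 + e - 1 - k = e + 2 := by omega
    simp only [h₁, h₂, h₃, h₄, Nat.succ_ne_zero, Nat.succ_pos, or_false, if_true, if_false,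
      Nat.add_sub_cancel, h₅]
    rw [pathMinor_add_two]
    ring

theorem pathFunctional_row_last (n : ℕ) (m l : ℤ) :
    pathFunctional (n + 2) m l (Pmat (n + 2) (m + 2 * l) (-l) (Fin.last (n + 1)))
      = m * fseq (m + 2 * l) (-l) (n + 1) := by
  rw [pathFunctional_apply,
    sum_Pmat_mul _ _ (fun j => l ^ (n + 2 - 1 - j) * pathMinor (m + 2 * l) (-l) j)]
  have h := pathMinor_last (m + 2 * l) (-l) n
  simp
  linear_combination h

theorem row_mem_range {n : ℕ} (a b : ℤ) (i : Fin n) :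
    Pmat n a b i ∈ LinearMap.range (Matrix.toLin' (Pmat n a b)ᵀ) :=
  ⟨Pi.single i 1, by ext j; simp⟩

theorem mem_range_of_pathFunctional_eq_zero {n : ℕ} {m l : ℤ} (hl : l ≠ 0) (h : IsCoprime l m)
    (k : ℕ) : ∀ x : Fin n → ℤ, (∀ j : Fin n, k ≤ j.val → x j = 0) →
      pathFunctional n m l x = 0 →
      x ∈ LinearMap.range (Matrix.toLin' (Pmat n (m + 2 * l) (-l))ᵀ) := by
  induction k with
  | zero =>
    intro x hx _
    rw [show x = 0 from funext fun j => hx j (Nat.zero_le _)]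
    exact Submodule.zero_mem _
  | succ k ih =>
    intro x hx hφ
    by_cases hk : k < n
    swap
    · exact ih x (fun j hj => absurd j.isLt (by omega)) hφ
    have hsum := hφ
    rw [pathFunctional_apply, ← Finset.add_sum_erase _ _ (Finset.mem_univ (⟨k, hk⟩ : Fin n))]
      at hsum
    cases k with
    | zero =>
      refine ih x (fun j _ => ?_) hφ
      by_cases hj : j.val = 0
      · rw [Finset.sum_eq_zero, add_zero] at hsum
        · have : x ⟨0, hk⟩ = 0 := by simpa [pathMinor, hl] using hsum
          rwa [show j = ⟨0, hk⟩ from Fin.ext hj]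
        · intro i hi
          have : i.val ≠ 0 := fun h0 => (Finset.mem_erase.1 hi).1 (Fin.ext h0)
          rw [hx i (by omega), zero_mul]
      · exact hx j (by omega)
    | succ k =>
      have hdvd : l ^ (n - 1 - (k + 1)) * l ∣ l ^ (n - 1 - (k + 1)) *
          (x ⟨k + 1, hk⟩ * pathMinor (m + 2 * l) (-l) (k + 1)) := by
        have hrest : l ^ (n - 1 - (k + 1)) * l ∣ ∑ j ∈ Finset.univ.erase (⟨k + 1, hk⟩ : Fin n),
            x j * (l ^ (n - 1 - j.val) * pathMinor (m + 2 * l) (-l) j) := by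
          refine Finset.dvd_sum fun j hj => ?_
          have hne : j.val ≠ k + 1 := fun h0 => (Finset.mem_erase.1 hj).1 (Fin.ext h0)
          by_cases hjk : k + 1 < j.val
          · simp [hx j (by omega)]
          · rw [← pow_succ]
            exact ((pow_dvd_pow l (by omega)).mul_right _).mul_left _
        have := (dvd_neg.2 hrest)
        rwa [← eq_neg_of_add_eq_zero_left hsum, mul_left_comm] at this
      obtain ⟨y, hy⟩ : l ∣ x ⟨k + 1, hk⟩ :=
        (isCoprime_pathMinor h (k + 1)).dvd_of_dvd_mul_right
          (Int.dvd_of_mul_dvd_mul_left (pow_ne_zero _ hl) hdvd)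
      have hrow := row_mem_range (m + 2 * l) (-l) (⟨k, by omega⟩ : Fin n)
      have hmem := ih (x + y • Pmat n (m + 2 * l) (-l) ⟨k, by omega⟩) ?_ ?_
      · simpa using Submodule.sub_mem _ hmem (Submodule.smul_mem _ y hrow)
      · intro j hj
        rcases hj.eq_or_lt with hj | hj
        · obtain rfl : j = ⟨k + 1, hk⟩ := Fin.ext hj.symm
          simp [Pmat, hy]
          ring
        · have h₁ : k ≠ j.val := by omega
          have h₂ : k + 1 ≠ j.val := by omega
          have h₃ : j.val + 1 ≠ k := by omega
          simp [Pmat, hx j (by omega), Fin.ext_iff, h₁, h₂, h₃]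
      · rw [map_add, map_smul, hφ, pathFunctional_row_of_lt _ _ _ hk]
        simp

theorem mem_range_Pmat_iff {n : ℕ} {m l : ℤ} (hl : l ≠ 0) (h : IsCoprime l m)
    (x : Fin (n + 2) → ℤ) :
    x ∈ LinearMap.range (Matrix.toLin' (Pmat (n + 2) (m + 2 * l) (-l))ᵀ) ↔
      m * fseq (m + 2 * l) (-l) (n + 1) ∣ pathFunctional (n + 2) m l x := by
  constructor
  · rintro ⟨y, rfl⟩
    have hy : Matrix.toLin' (Pmat (n + 2) (m + 2 * l) (-l))ᵀ y
        = ∑ i, y i • Pmat (n + 2) (m + 2 * l) (-l) i := by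
      rw [Matrix.toLin'_apply, Matrix.mulVec_transpose, Matrix.vecMul_eq_sum]
    rw [hy, map_sum]
    refine Finset.dvd_sum fun i _ => ?_
    rw [map_smul]
    refine Dvd.dvd.mul_left ?_ _
    by_cases hi : i.val + 1 < n + 2
    · rw [pathFunctional_row_of_lt _ _ _ hi]
      exact dvd_zero _
    · obtain rfl : i = Fin.last (n + 1) := Fin.ext (by simp; omega)
      rw [pathFunctional_row_last]
  · rintro ⟨c, hc⟩
    have hrow := row_mem_range (m + 2 * l) (-l) (Fin.last (n + 1))
    have hmem := mem_range_of_pathFunctional_eq_zero hl h (n + 2)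
      (x - c • Pmat (n + 2) (m + 2 * l) (-l) (Fin.last (n + 1)))
      (fun j hj => absurd j.isLt (by omega))
      (by rw [map_sub, map_smul, pathFunctional_row_last, hc, smul_eq_mul]; ring)
    simpa using Submodule.add_mem _ hmem (Submodule.smul_mem _ c hrow)

theorem exists_pathFunctional_eq_one (n : ℕ) {m l : ℤ} (h : IsCoprime l m) :
    ∃ v, pathFunctional (n + 1) m l v = 1 := by
  obtain ⟨u, w, huw⟩ := (isCoprime_pathMinor h n).pow_left (m := n)
  refine ⟨Pi.single 0 u + Pi.single (Fin.last n) w, ?_⟩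
  rw [map_add, pathFunctional_single, pathFunctional_single]
  simpa [pathMinor] using huw

end Tridiagonal

/-- Let `r = gcd(l,m)` and let `t` be the integer with
`r^(n-1)·t = f_{n-1}(m+2l, -l)`.  The critical group of the `m`-cone of
`P_n(l)`, i.e. the cokernel `ℤⁿ / P_n(m+2l, -l)ᵀ ℤⁿ`, is isomorphic to
`(ℤ_r)^(n-1) ⊕ ℤ_{m·t}`. -/
theorem criticalGroup_cone_path (m l n : ℕ) (hl : 1 ≤ l) (hn : 2 ≤ n) (t : ℤ)
    (ht : (Nat.gcd l m : ℤ) ^ (n - 1) * t = fseq ((m : ℤ) + 2 * l) (-(l : ℤ)) (n - 1)) :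
    Nonempty
      (((Fin n → ℤ) ⧸
          LinearMap.range (Matrix.toLin' (Pmat n ((m : ℤ) + 2 * l) (-(l : ℤ)))ᵀ)) ≃+
        ((Fin (n - 1) → ZMod (Nat.gcd l m)) × ZMod ((m * t).natAbs))) := by
  obtain ⟨k, rfl⟩ : ∃ k, n = k + 2 := ⟨n - 2, by omega⟩
  have hr : 0 < Nat.gcd l m := Nat.gcd_pos_of_pos_left _ hl
  obtain ⟨l', m', hcop, hl', hm'⟩ := Nat.exists_coprime l m
  generalize Nat.gcd l m = r at *
  subst hl' hm'
  have hr0 : (r : ℤ) ≠ 0 := by exact_mod_cast hr.ne'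
  have hl0 : (l' : ℤ) ≠ 0 := by
    rintro h0
    simp [Int.natCast_eq_zero.1 h0] at hl
  have hcop' : IsCoprime (l' : ℤ) m' := Nat.isCoprime_iff_coprime.2 hcop
  have ha : ((m' * r : ℕ) : ℤ) + 2 * (l' * r : ℕ) = r * (m' + 2 * l') := by push_cast; ring
  have hb : -((l' * r : ℕ) : ℤ) = r * -l' := by push_cast; ring
  rw [ha, hb] at ht ⊢
  rw [fseq_mul_mul] at ht
  obtain rfl : t = fseq ((m' : ℤ) + 2 * l') (-l') (k + 1) := mul_left_cancel₀ (pow_ne_zero _ hr0) ht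
  obtain ⟨v, hv⟩ := exists_pathFunctional_eq_one (k + 1) hcop'
  rw [show ((m' * r : ℕ) : ℤ) * fseq ((m' : ℤ) + 2 * l') (-l') (k + 1)
    = r * (m' * fseq ((m' : ℤ) + 2 * l') (-l') (k + 1)) by push_cast; ring]
  refine nonempty_quotient_addEquiv_of_functional _ hv r _ _ fun x => ?_
  simp only [← mem_range_Pmat_iff hl0 hcop', Pmat_mul_mul, Matrix.transpose_smul, map_smul]
  constructor
  · rintro ⟨y, rfl⟩
    exact ⟨_, ⟨y, rfl⟩, rfl⟩
  · rintro ⟨_, ⟨y, rfl⟩, rfl⟩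
    exact ⟨y, rfl⟩
end

section
/- Let 𝔸 be a commutative ring with identity, m ≥ 2, and a, b ∈ 𝔸 such that the equation a·x + b·y = 1 has a solution in 𝔸. Let K_{m,m}(a,b) = a·I_{2m} + b·A(K_{m,m}) be the 2m×2m matrix whose rows and columns are indexed by u_1,…,u_m,v_1,…,v_m, with diagonal entries a, entries b in every position (u_i, v_j) and (v_j, u_i), and 0 in all positions (u_i, u_j) and (v_i, v_j) with i ≠ j. Then K_{m,m}(a,b) is unitarily equivalent to the block diagonal matrix I_2 ⊕ a·I_{2(m−2)} ⊕ a·[[a, m·b],[m·b, a]]. -/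
/-- The `2m×2m` matrix `K_{m,m}(a,b) = a·I_{2m} + b·A(K_{m,m})`, where the rows
and columns `0, …, m-1` correspond to `u_1, …, u_m` and `m, …, 2m-1` to
`v_1, …, v_m`: diagonal entries `a`, entries `b` in positions joining the two
parts, `0` elsewhere. -/
def Kmm {A : Type*} [CommRing A] (m : ℕ) (a b : A) :
    Matrix (Fin (2 * m)) (Fin (2 * m)) A :=
  Matrix.of fun i j =>
    if i = j then a
    else if (i.val < m ∧ m ≤ j.val) ∨ (j.val < m ∧ m ≤ i.val) then b
    else 0

open Matrix

/-- `N = P * M * Q` for square matrices `P`, `Q` whose determinants are mutually inverse. -/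
def DetEquiv {A ι : Type*} [CommRing A] [Fintype ι] [DecidableEq ι] (M N : Matrix ι ι A) : Prop :=
  ∃ P Q : Matrix ι ι A, P.det * Q.det = 1 ∧ N = P * M * Q

namespace DetEquiv

variable {A ι κ : Type*} [CommRing A] [Fintype ι] [DecidableEq ι] [Fintype κ] [DecidableEq κ]

theorem trans {M N L : Matrix ι ι A} (h₁ : DetEquiv M N) (h₂ : DetEquiv N L) : DetEquiv M L := by
  obtain ⟨P, Q, hd, rfl⟩ := h₁
  obtain ⟨P', Q', hd', rfl⟩ := h₂
  refine ⟨P' * P, Q * Q', ?_, by simp only [Matrix.mul_assoc]⟩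
  rw [det_mul, det_mul]
  linear_combination P'.det * Q'.det * hd + hd'

theorem conj {P Q : Matrix ι ι A} (h : P * Q = 1) (M : Matrix ι ι A) :
    DetEquiv M (P * M * Q) :=
  ⟨P, Q, by rw [← det_mul, h, det_one], rfl⟩

theorem submatrix {M N : Matrix ι ι A} (h : DetEquiv M N) (e : κ ≃ ι) :
    DetEquiv (M.submatrix e e) (N.submatrix e e) := by
  obtain ⟨P, Q, hd, rfl⟩ := h
  exact ⟨P.submatrix e e, Q.submatrix e e, by simpa using hd, by simp [submatrix_mul_equiv]⟩

theorem submatrix_equiv (M : Matrix ι ι A) (e₁ e₂ : κ ≃ ι) :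
    DetEquiv (M.submatrix e₁ e₁) (M.submatrix e₂ e₂) := by
  have h := conj (A := A) (P := (1 : Matrix ι ι A).submatrix e₂ e₁)
    (Q := (1 : Matrix ι ι A).submatrix e₁ e₂) (by simp [submatrix_mul_equiv])
    (M.submatrix e₁ e₁)
  simpa [submatrix_mul_equiv] using h

theorem fromBlocks_left {M N : Matrix ι ι A} (h : DetEquiv M N) (D : Matrix κ κ A) :
    DetEquiv (fromBlocks M 0 0 D) (fromBlocks N 0 0 D) := by
  obtain ⟨P, Q, hd, rfl⟩ := h
  exact ⟨fromBlocks P 0 0 1, fromBlocks Q 0 0 1, by simpa using hd,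
    by simp [fromBlocks_multiply]⟩

/-- If `N` splits off a `1` in position `k`, the two determinants can both be made `1`. -/
theorem exists_det_eq_one {M N : Matrix ι ι A} (h : DetEquiv M N) (k : ι) (hk : N k k = 1)
    (hrow : ∀ j, j ≠ k → N k j = 0) (hcol : ∀ i, i ≠ k → N i k = 0) :
    ∃ P Q : Matrix ι ι A, P.det = 1 ∧ Q.det = 1 ∧ N = P * M * Q := by
  obtain ⟨P, Q, hd, hN⟩ := h
  have hdet (c : A) : (diagonal (Function.update (1 : ι → A) k c)).det = c := by
    rw [det_diagonal, Finset.prod_update_of_mem (Finset.mem_univ k)]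
    simp
  refine ⟨diagonal (Function.update 1 k Q.det) * P, Q * diagonal (Function.update 1 k P.det),
    by rw [det_mul, hdet, mul_comm, hd], by rw [det_mul, hdet, mul_comm, hd], ?_⟩
  have hS : N = diagonal (Function.update 1 k Q.det) * N *
      diagonal (Function.update 1 k P.det) := by
    ext i j
    rw [mul_diagonal, diagonal_mul]
    by_cases hi : i = k <;> by_cases hj : j = k
    · subst hi hj
      simp [hk, mul_comm Q.det, hd]
    · subst hi
      simp [hrow j hj]
    · subst hj
      simp [hcol i hi]
    · simp [hi, hj]
  rw [hS, hN]
  simp only [Matrix.mul_assoc]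

end DetEquiv

/-- The all-ones matrix is similar to one supported in a `2 × 2` block. -/
theorem ones_similar {A : Type*} [CommRing A] (n : ℕ) :
    ∃ S T : Matrix (Fin 2 ⊕ Fin n) (Fin 2 ⊕ Fin n) A, S * T = 1 ∧
      S * (of fun _ _ => 1) * T = fromBlocks !![0, 0; 1, ((n + 2 : ℕ) : A)] 0 0 0 := by
  refine ⟨fromBlocks !![1, -((n : A) + 1); 0, 1] (of fun i _ => if i = 0 then 1 else 0)
      (of fun _ j => if j = 1 then -1 else 0) 1,
    fromBlocks !![1, 1; 0, 1] (of fun i _ => if i = 0 then -1 else 0)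
      (of fun _ j => if j = 1 then 1 else 0) 1, ?_, ?_⟩
  · rw [fromBlocks_multiply, ← fromBlocks_one]
    congr 1
    all_goals
      ext i j
      try fin_cases i
      all_goals
        try fin_cases j
        all_goals simp [Matrix.mul_apply, one_apply, vecHead, vecTail]
  · ext (i | i) (j | j)
    all_goals
      try fin_cases i
      all_goals
        try fin_cases j
        all_goals simp [Matrix.mul_apply, one_apply, Fintype.sum_sum_type]
    all_goals ring

/-- The equivalence in dimension four that splits off two ones. -/
theorem detEquiv_fin_four {A : Type*} [CommRing A] {a b x y : A} (h : a * x + b * y = 1) (c : A) :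
    DetEquiv !![a, 0, 0, 0; 0, a, b, c * b; 0, 0, a, 0; b, c * b, 0, a]
      !![1, 0, 0, 0; 0, 1, 0, 0; 0, 0, a * a, a * (c * b); 0, 0, a * (c * b), a * a] := by
  refine ⟨!![x, 0, 0, y; 0, y, x, 0; 0, a, -b, 0; -b, 0, 0, a],
    !![1, 0, -(y * c * b), -(y * a); 0, 0, 1, 0; 0, 1, -(y * a), -(y * c * b); 0, 0, 0, 1], ?_, ?_⟩
  · simp [det_succ_row_zero, Fin.sum_univ_succ, Fin.succAbove]
    linear_combination (a * x + b * y + 1) * h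
  · ext i j
    fin_cases i <;> fin_cases j <;> simp [Matrix.mul_apply, Fin.sum_univ_succ] <;>
      first
        | ring1
        | linear_combination -h
        | linear_combination (a * y) * h
        | linear_combination (y * b * c) * h

/-- `Kmm` in the block form given by the two parts. -/
theorem exists_equiv_Kmm {A : Type*} [CommRing A] (n : ℕ) (a b : A) :
    ∃ e : (Fin 2 ⊕ Fin n) ⊕ (Fin 2 ⊕ Fin n) ≃ Fin (2 * (n + 2)),
      (Kmm (n + 2) a b).submatrix e e =
        fromBlocks (a • 1) (b • of fun _ _ => 1) (b • of fun _ _ => 1) (a • 1) := by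
  have key (e : Fin 2 ⊕ Fin n ≃ Fin (n + 2)) :
      (Kmm (n + 2) a b).submatrix
          ((e.sumCongr e).trans (finSumFinEquiv.trans (finCongr (two_mul _).symm)))
          ((e.sumCongr e).trans (finSumFinEquiv.trans (finCongr (two_mul _).symm))) =
        fromBlocks (a • 1) (b • of fun _ _ => 1) (b • of fun _ _ => 1) (a • 1) := by
    ext (i | i) (j | j)
    · have hi := (e i).isLt
      have hj := (e j).isLt
      simp [Kmm, one_apply, hi.not_ge, hj.not_ge]
    · simp [Kmm, Fin.ext_iff]
      grind
    · simp [Kmm, Fin.ext_iff]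
      grind
    · simp [Kmm, one_apply]
  exact ⟨_, key (finSumFinEquiv.trans (finCongr (add_comm _ _)))⟩

/-- With respect to some ordering, the block form of `Kmm` is equivalent to a matrix
with a `4 × 4` block and `a` along the rest of the diagonal. -/
theorem detEquiv_fromBlocks_ones {A : Type*} [CommRing A] {a b : A}
    (h : ∃ x y : A, a * x + b * y = 1) (n : ℕ) :
    ∃ e : Fin 4 ⊕ (Fin n ⊕ Fin n) ≃ (Fin 2 ⊕ Fin n) ⊕ (Fin 2 ⊕ Fin n),
      DetEquiv ((fromBlocks (a • 1) (b • of fun _ _ => 1) (b • of fun _ _ => 1) (a • 1) :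
          Matrix ((Fin 2 ⊕ Fin n) ⊕ (Fin 2 ⊕ Fin n)) _ A).submatrix e e)
        (fromBlocks !![1, 0, 0, 0; 0, 1, 0, 0;
            0, 0, a * a, a * (((n + 2 : ℕ) : A) * b); 0, 0, a * (((n + 2 : ℕ) : A) * b), a * a]
          0 0 (a • 1)) := by
  obtain ⟨x, y, h⟩ := h
  obtain ⟨S, T, hST, hJ⟩ := ones_similar (A := A) n
  let e := ((finSumFinEquiv (m := 2) (n := 2)).symm.sumCongr (Equiv.refl (Fin n ⊕ Fin n))).trans
    (Equiv.sumSumSumComm _ _ _ _)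
  refine ⟨e, ?_⟩
  have h₁ := (DetEquiv.conj (P := fromBlocks S 0 0 S) (Q := fromBlocks T 0 0 T)
    (by simp [fromBlocks_multiply, hST])
    (fromBlocks (a • 1) (b • of fun _ _ => 1) (b • of fun _ _ => 1) (a • 1))).submatrix e
  refine h₁.trans ?_
  have h₂ := (detEquiv_fin_four h ((n + 2 : ℕ) : A)).fromBlocks_left
    (a • (1 : Matrix (Fin n ⊕ Fin n) (Fin n ⊕ Fin n) A))
  convert h₂ using 1
  simp only [fromBlocks_multiply, Matrix.zero_mul, Matrix.mul_zero, add_zero, zero_add,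
    Matrix.mul_smul, Matrix.smul_mul, smul_zero, Matrix.mul_one, hST, hJ]
  ext (i | i | i) (j | j | j)
  · obtain ⟨i, rfl⟩ := finSumFinEquiv.surjective i
    obtain ⟨j, rfl⟩ := finSumFinEquiv.surjective j
    rcases i with i | i <;> rcases j with j | j <;> fin_cases i <;> fin_cases j <;>
      simp [e] <;> first | rfl | exact mul_comm _ _
  · obtain ⟨i, rfl⟩ := finSumFinEquiv.surjective i
    rcases i with i | i <;> simp [e]
  · obtain ⟨i, rfl⟩ := finSumFinEquiv.surjective i
    rcases i with i | i <;> simp [e]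
  · obtain ⟨j, rfl⟩ := finSumFinEquiv.surjective j
    rcases j with j | j <;> simp [e]
  · simp [e, one_apply]
  · simp [e, one_apply]
  · obtain ⟨j, rfl⟩ := finSumFinEquiv.surjective j
    rcases j with j | j <;> simp [e]
  · simp [e, one_apply]
  · simp [e, one_apply]

/-- The block form of the diagonal sum `I_2 ⊕ a·I_{2n} ⊕ [[a², c], [c, a²]]`. -/
theorem exists_equiv_target {A : Type*} [CommRing A] (n : ℕ) (a c : A) :
    ∃ f : Fin 4 ⊕ (Fin n ⊕ Fin n) ≃ Fin (2 * (n + 2)),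
      (of fun i j : Fin (2 * (n + 2)) =>
          if i = j then
            (if i.val < 2 then 1 else if i.val < 2 * (n + 2) - 2 then a else a * a)
          else if 2 * (n + 2) - 2 ≤ i.val ∧ 2 * (n + 2) - 2 ≤ j.val then c
          else 0).submatrix f f =
        fromBlocks !![1, 0, 0, 0; 0, 1, 0, 0; 0, 0, a * a, c; 0, 0, c, a * a] 0 0 (a • 1) := by
  let g : Fin 4 ⊕ (Fin n ⊕ Fin n) → Fin (2 * (n + 2)) :=
    Sum.elim (fun i => ⟨if i.val < 2 then i else 2 * n + i, by split_ifs <;> lia⟩)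
      (Sum.elim (fun i => ⟨2 + i, by lia⟩) (fun i => ⟨2 + n + i, by lia⟩))
  have hg : Function.Bijective g := by
    refine (Fintype.bijective_iff_injective_and_card g).2 ⟨?_, by simp; lia⟩
    rintro (i | i | i) (j | j | j) <;> simp [g, Fin.ext_iff] <;> (try split_ifs) <;> lia
  refine ⟨Equiv.ofBijective g hg, ?_⟩
  ext (i | i | i) (j | j | j)
  · fin_cases i <;> fin_cases j <;> simp [g, Fin.ext_iff, -Fin.mk_one] <;> lia
  all_goals simp [g, Fin.ext_iff, one_apply]
  all_goals grind

/-- For `m ≥ 2` and `a, b` with `a·x + b·y = 1` solvable, `K_{m,m}(a,b)` is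
unitarily equivalent to `I_2 ⊕ a·I_{2(m-2)} ⊕ a·[[a, m·b],[m·b, a]]`. -/
theorem Kmm_unitarily_equiv {A : Type*} [CommRing A] (m : ℕ) (hm : 2 ≤ m)
    (a b : A) (h : ∃ x y : A, a * x + b * y = 1) :
    ∃ P Q : Matrix (Fin (2 * m)) (Fin (2 * m)) A, P.det = 1 ∧ Q.det = 1 ∧
      (Matrix.of fun i j : Fin (2 * m) =>
          if i = j then
            (if i.val < 2 then 1 else if i.val < 2 * m - 2 then a else a * a)
          else if 2 * m - 2 ≤ i.val ∧ 2 * m - 2 ≤ j.val then a * ((m : A) * b)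
          else 0)
        = P * Kmm m a b * Q := by
  obtain ⟨n, rfl⟩ := Nat.exists_eq_add_of_le' hm
  obtain ⟨e, he⟩ := exists_equiv_Kmm n a b
  obtain ⟨e', he'⟩ := detEquiv_fromBlocks_ones h n
  obtain ⟨f, hf⟩ := exists_equiv_target n a (a * (((n + 2 : ℕ) : A) * b))
  rw [← he, ← hf, submatrix_submatrix] at he'
  have h' := (DetEquiv.submatrix_equiv (Kmm (n + 2) a b) f (e'.trans e)).trans he'
  replace h' := h'.submatrix f.symm
  simp only [submatrix_submatrix, Equiv.self_comp_symm, submatrix_id_id] at h'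
  refine h'.exists_det_eq_one ⟨0, by lia⟩ (by simp) ?_ ?_
  · intro j hj
    have hj' : 0 ≠ j.val := fun h => hj (Fin.ext h.symm)
    simp [Fin.ext_iff, hj']
  · intro i hi
    have hi' : i.val ≠ 0 := fun h => hi (Fin.ext h)
    simp [Fin.ext_iff, hi']
end

section
/- Let m ≥ 2, l ≥ 1, n ≥ 0, r = gcd(l, n), and s = gcd(m·l, n). The reduced Laplacian of the n-cone of the complete bipartite graph K_{m,m} with all edges of multiplicity l is the 2m×2m integer matrix (n+m·l)·I_{2m} − l·A(K_{m,m}). Its cokernel, the critical group K(c_n(K_{m,m}(l))), is isomorphic to (ℤ_r)² ⊕ (ℤ_{n+m·l})^{2(m−2)} ⊕ ℤ_{(n+m·l)·s/r} ⊕ ℤ_{n·(n+m·l)·(n+2m·l)/(r·s)}. -/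
open Matrix

/-- The reduced Laplacian of the `n`-cone of the complete bipartite graph
`K_{m,m}` with all edges of multiplicity `l`, namely the `2m×2m` integer
matrix `(n+m·l)·I_{2m} - l·A(K_{m,m})`.  Rows and columns `0, …, m-1`
correspond to `u_1, …, u_m` and `m, …, 2m-1` to `v_1, …, v_m`. -/
def coneKmmLap (m l n : ℕ) : Matrix (Fin (2 * m)) (Fin (2 * m)) ℤ :=
  Matrix.of fun i j =>
    if i = j then (n : ℤ) + m * l
    else if (i.val < m ∧ m ≤ j.val) ∨ (j.val < m ∧ m ≤ i.val) then -(l : ℤ)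
    else 0

/-- If `Φ ∘ M = D ∘ Ψ` with `Φ` bijective and `Ψ` surjective, and `T` is the cokernel of `D`,
then the cokernel of `M` is isomorphic to `T`. -/
lemma nonempty_coker_equiv_of_ladder {V W X Y T : Type*} [AddCommGroup V] [AddCommGroup W]
    [AddCommGroup X] [AddCommGroup Y] [AddCommGroup T]
    (M : V →ₗ[ℤ] W) (D : X →ₗ[ℤ] Y) (C : Y →ₗ[ℤ] T) (Φ : W ≃ₗ[ℤ] Y) (Ψ : V → X)
    (hΨ : Function.Surjective Ψ) (hC : Function.Surjective C) (hDC : Function.Exact D C)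
    (h : ∀ x, Φ (M x) = D (Ψ x)) :
    Nonempty ((W ⧸ LinearMap.range M) ≃+ T) := by
  have hexact : Function.Exact M (C ∘ₗ Φ.toLinearMap) := by
    intro w
    constructor
    · intro hw
      obtain ⟨x, hx⟩ := (hDC (Φ w)).1 hw
      obtain ⟨v, rfl⟩ := hΨ x
      exact ⟨v, Φ.injective ((h v).trans hx)⟩
    · rintro ⟨v, rfl⟩
      exact (hDC _).2 ⟨Ψ v, (h v).symm⟩
  exact ⟨(hexact.linearEquivOfSurjective (hC.comp Φ.surjective)).toAddEquiv⟩

/-- The coordinates of `x` obtained from its entry sum, its entry at `1`, and the differences of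
its remaining entries (from index `2` on) with the entry at `1`. -/
def sumDiffEquiv (k : ℕ) : (Fin (k + 2) → ℤ) ≃ₗ[ℤ] ℤ × ℤ × (Fin k → ℤ) where
  toFun x := (∑ i, x i, x 1, fun i => x i.succ.succ - x 1)
  invFun y := Fin.cons (y.1 - y.2.1 - ∑ i, (y.2.2 i + y.2.1))
    (Fin.cons y.2.1 fun i => y.2.2 i + y.2.1 : Fin (k + 1) → ℤ)
  map_add' x y := by
    ext <;> simp [Finset.sum_add_distrib]
    ring
  map_smul' c x := by
    ext <;> simp [Finset.mul_sum, mul_sub]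
  left_inv x := by
    funext i
    refine Fin.cases ?_ (fun i => Fin.cases ?_ (fun i => ?_) i) i
    · simp [Fin.sum_univ_succ]
      ring
    · simp
    · simp
  right_inv y := by
    ext
    · simp [Fin.sum_univ_succ]
    · simp only [← Fin.succ_zero_eq_one, Fin.cons_succ, Fin.cons_zero]
    · simp only [← Fin.succ_zero_eq_one, Fin.cons_succ, Fin.cons_zero, add_sub_cancel_right]

/-- Concatenating two index blocks of length `m`. -/
def blockEquiv (m : ℕ) : Fin m ⊕ Fin m ≃ Fin (2 * m) :=
  finSumFinEquiv.trans (finCongr (two_mul m).symm)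

@[simp]
lemma blockEquiv_inl_val (m : ℕ) (i : Fin m) : (blockEquiv m (.inl i)).val = i := rfl

@[simp]
lemma blockEquiv_inr_val (m : ℕ) (i : Fin m) : (blockEquiv m (.inr i)).val = m + i := rfl

/-- Splitting a vector of length `2 * m` into its two halves. -/
def halvesEquiv (m : ℕ) : (Fin (2 * m) → ℤ) ≃ₗ[ℤ] (Fin m → ℤ) × (Fin m → ℤ) :=
  LinearEquiv.funCongrLeft ℤ ℤ (blockEquiv m) ≪≫ₗ
    LinearEquiv.sumArrowLequivProdArrow (Fin m) (Fin m) ℤ ℤ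

lemma halvesEquiv_apply (m : ℕ) (x : Fin (2 * m) → ℤ) :
    halvesEquiv m x = (fun i => x (blockEquiv m (.inl i)), fun i => x (blockEquiv m (.inr i))) :=
  rfl

lemma halvesEquiv_coneKmmLap (m l n : ℕ) (x : Fin (2 * m) → ℤ) :
    halvesEquiv m (Matrix.toLin' (coneKmmLap m l n)ᵀ x) =
      (fun i => ((n : ℤ) + m * l) * (halvesEquiv m x).1 i - l * ∑ j, (halvesEquiv m x).2 j,
        fun i => ((n : ℤ) + m * l) * (halvesEquiv m x).2 i - l * ∑ j, (halvesEquiv m x).1 j) := by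
  simp only [halvesEquiv_apply, Matrix.toLin'_apply, Matrix.mulVec, dotProduct,
    Matrix.transpose_apply, ← (blockEquiv m).sum_comp, Fintype.sum_sum_type, coneKmmLap,
    Matrix.of_apply, EmbeddingLike.apply_eq_iff_eq, blockEquiv_inl_val, blockEquiv_inr_val]
  have hlt : ∀ i : Fin m, ¬ m ≤ i.val := fun i => i.isLt.not_ge
  ext i <;> simp [hlt, ite_mul, Finset.mul_sum, sub_eq_add_neg, add_comm]

/-- The map obtained from the Laplacian on the four coordinates that interact. -/
def coupledMap (N l k : ℤ) : ℤ × ℤ × ℤ × ℤ →ₗ[ℤ] ℤ × ℤ × ℤ × ℤ where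
  toFun x := (N * x.1 - k * x.2.2.1, N * x.2.1 - l * x.2.2.1,
    N * x.2.2.1 - k * x.1, N * x.2.2.2 - l * x.1)
  map_add' x y := by
    ext <;> simp <;> ring
  map_smul' c x := by
    ext <;> simp <;> ring

/-- The change of coordinates on the target which brings `coupledMap` to Smith normal form. -/
def targetEquiv (N u k a b n₁ k₁ : ℤ) (h : a * k₁ + b * n₁ = 1) :
    (ℤ × ℤ × ℤ × ℤ) ≃ₗ[ℤ] ℤ × ℤ × ℤ × ℤ where
  toFun x :=
    let c := x.1 + u * N * x.2.2.2 - k * u * x.2.1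
    let d := x.2.2.1 + u * N * x.2.1 - k * u * x.2.2.2
    (x.2.1, x.2.2.2, b * (c + d) - a * d, k₁ * (c + d) + n₁ * d)
  invFun y :=
    let e := n₁ * y.2.2.1 + a * y.2.2.2
    let d := b * y.2.2.2 - k₁ * y.2.2.1
    (e - d - u * N * y.2.1 + k * u * y.1, y.1, d - u * N * y.1 + k * u * y.2.1, y.2.1)
  map_add' x y := by
    ext <;> simp <;> ring
  map_smul' c x := by
    ext <;> simp <;> ring
  left_inv x := by
    ext <;> dsimp only
    · linear_combination (x.1 + u * N * x.2.2.2 - k * u * x.2.1) * h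
    · linear_combination (x.2.2.1 + u * N * x.2.1 - k * u * x.2.2.2) * h
  right_inv y := by
    ext <;> dsimp only
    · linear_combination y.2.2.1 * h
    · linear_combination y.2.2.2 * h

/-- The change of coordinates on the source which brings `coupledMap` to Smith normal form. -/
def sourceMap (N l u v a b n₁ : ℤ) (x : ℤ × ℤ × ℤ × ℤ) : ℤ × ℤ × ℤ × ℤ :=
  (N * x.2.1 - l * x.2.2.1, N * x.2.2.2 - l * x.1,
    u * x.2.2.2 + v * x.1 + ((2 * b - a) * n₁ - 1) * (u * x.2.1 + v * x.2.2.1),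
    u * x.2.1 + v * x.2.2.1)

lemma sourceMap_surjective (N l u v a b n₁ : ℤ) (h : u * l + v * N = 1) :
    Function.Surjective (sourceMap N l u v a b n₁) := by
  rintro ⟨g₁, g₂, w, h₁⟩
  refine ⟨(-u * g₂ + N * (w - ((2 * b - a) * n₁ - 1) * h₁), v * g₁ + l * h₁,
    -u * g₁ + N * h₁, v * g₂ + l * (w - ((2 * b - a) * n₁ - 1) * h₁)), ?_⟩
  ext <;> dsimp only [sourceMap]
  · linear_combination g₁ * h
  · linear_combination g₂ * h
  · linear_combination w * h
  · linear_combination h₁ * h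

lemma targetEquiv_coupledMap (r t N l k u v a b n₁ k₁ : ℤ) (hN : N = t * n₁ + t * k₁)
    (hk : k = t * k₁) (huv : u * l + v * N = 1) (hab : a * k₁ + b * n₁ = 1)
    (x : ℤ × ℤ × ℤ × ℤ) :
    targetEquiv N u k a b n₁ k₁ hab (coupledMap (r * N) (r * l) (r * k) x) =
      (r * (sourceMap N l u v a b n₁ x).1, r * (sourceMap N l u v a b n₁ x).2.1,
        r * N * t * (sourceMap N l u v a b n₁ x).2.2.1,
        r * N * t * n₁ * (n₁ + 2 * k₁) * (sourceMap N l u v a b n₁ x).2.2.2) := by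
  obtain ⟨S, p, T, q⟩ := x
  subst hk hN
  ext <;> simp only [targetEquiv, coupledMap, sourceMap, LinearEquiv.coe_mk, LinearMap.coe_mk,
    AddHom.coe_mk]
  · ring
  · ring
  · linear_combination r * (t * n₁ + t * k₁) * t * (u * q + v * S - u * p - v * T) * hab -
      r * (b * ((t * n₁ + t * k₁) * S - t * k₁ * T) +
        (b - a) * ((t * n₁ + t * k₁) * T - t * k₁ * S)) * huv
  · linear_combination -r * (k₁ * ((t * n₁ + t * k₁) * S - t * k₁ * T) +
        (k₁ + n₁) * ((t * n₁ + t * k₁) * T - t * k₁ * S)) * huv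

/-- The diagonal map with the invariant factors `d₁, d₂, d₃, d₄` on the first four coordinates
and `d` on the remaining ones. -/
def diagonalMap (ι : Type*) (d₁ d₂ d₃ d₄ d : ℤ) :
    (ℤ × ℤ × ℤ × ℤ) × (ι → ℤ) →ₗ[ℤ] (ℤ × ℤ × ℤ × ℤ) × (ι → ℤ) :=
  ((d₁ • LinearMap.id).prodMap ((d₂ • LinearMap.id).prodMap
    ((d₃ • LinearMap.id).prodMap (d₄ • LinearMap.id)))).prodMap (d • LinearMap.id)

/-- The cokernel map of `diagonalMap`. -/
def diagonalCoker (ι : Type*) (d₁ d₂ d₃ d₄ d : ℕ) :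
    (ℤ × ℤ × ℤ × ℤ) × (ι → ℤ) →ₗ[ℤ]
      (ZMod d₁ × ZMod d₂) × (ι → ZMod d) × ZMod d₃ × ZMod d₄ where
  toFun x := ((x.1.1, x.1.2.1), fun i => x.2 i, x.1.2.2.1, x.1.2.2.2)
  map_add' x y := by
    ext <;> simp
  map_smul' c x := by
    ext <;> simp

lemma diagonalCoker_surjective (ι : Type*) (d₁ d₂ d₃ d₄ d : ℕ) :
    Function.Surjective (diagonalCoker ι d₁ d₂ d₃ d₄ d) := by
  rintro ⟨⟨a, b⟩, w, c, e⟩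
  choose w' hw' using fun i => ZMod.intCast_surjective (w i)
  obtain ⟨a, rfl⟩ := ZMod.intCast_surjective a
  obtain ⟨b, rfl⟩ := ZMod.intCast_surjective b
  obtain ⟨c, rfl⟩ := ZMod.intCast_surjective c
  obtain ⟨e, rfl⟩ := ZMod.intCast_surjective e
  obtain rfl : (fun i => (w' i : ZMod d)) = w := funext hw'
  exact ⟨((a, b, c, e), w'), rfl⟩

lemma exact_diagonalMap_diagonalCoker (ι : Type*) (d₁ d₂ d₃ d₄ d : ℕ) :
    Function.Exact (diagonalMap ι d₁ d₂ d₃ d₄ d) (diagonalCoker ι d₁ d₂ d₃ d₄ d) := by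
  rintro ⟨⟨a, b, c, e⟩, w⟩
  simp only [diagonalCoker, diagonalMap, LinearMap.coe_mk, AddHom.coe_mk, Prod.mk_eq_zero,
    funext_iff, Pi.zero_apply, ZMod.intCast_zmod_eq_zero_iff_dvd]
  constructor
  · rintro ⟨⟨⟨a, rfl⟩, ⟨b, rfl⟩⟩, hw, ⟨c, rfl⟩, ⟨e, rfl⟩⟩
    choose w' hw' using hw
    obtain rfl : w = fun i => d * w' i := funext hw'
    exact ⟨((a, b, c, e), w'), rfl⟩
  · rintro ⟨⟨⟨a, b, c, e⟩, w⟩, h⟩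
    obtain ⟨⟨rfl, rfl, rfl, rfl⟩, rfl⟩ := by simpa [Prod.ext_iff] using h
    simp

/-- Separating the coordinates given by `sumDiffEquiv` on both halves into the four coupled ones
and the remaining ones. -/
def separateEquiv (k : ℕ) :
    ((ℤ × ℤ × (Fin k → ℤ)) × (ℤ × ℤ × (Fin k → ℤ))) ≃ₗ[ℤ]
      (ℤ × ℤ × ℤ × ℤ) × (Fin (2 * k) → ℤ) where
  toFun x := ((x.1.1, x.1.2.1, x.2.1, x.2.2.1), (halvesEquiv k).symm (x.1.2.2, x.2.2.2))
  invFun y := ((y.1.1, y.1.2.1, (halvesEquiv k y.2).1),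
    (y.1.2.2.1, y.1.2.2.2, (halvesEquiv k y.2).2))
  map_add' x y := by
    simp only [Prod.fst_add, Prod.snd_add, ← map_add, Prod.mk_add_mk]
  map_smul' c x := by
    simp only [Prod.smul_fst, Prod.smul_snd, ← map_smul, Prod.smul_mk, RingHom.id_apply]
  left_inv x := by simp
  right_inv y := by simp

/-- Coordinates in which the reduced Laplacian is `coupledMap` plus a scalar map. -/
def coordEquiv (k : ℕ) :
    (Fin (2 * (k + 2)) → ℤ) ≃ₗ[ℤ] (ℤ × ℤ × ℤ × ℤ) × (Fin (2 * k) → ℤ) :=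
  halvesEquiv (k + 2) ≪≫ₗ (sumDiffEquiv k).prodCongr (sumDiffEquiv k) ≪≫ₗ separateEquiv k

lemma coordEquiv_coneKmmLap (k l n : ℕ) (x : Fin (2 * (k + 2)) → ℤ) :
    coordEquiv k (Matrix.toLin' (coneKmmLap (k + 2) l n)ᵀ x) =
      (coupledMap ((n : ℤ) + (k + 2 : ℕ) * l) l ((k + 2 : ℕ) * l) (coordEquiv k x).1,
        ((n : ℤ) + (k + 2 : ℕ) * l) • (coordEquiv k x).2) := by
  simp only [coordEquiv, LinearEquiv.trans_apply, halvesEquiv_coneKmmLap]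
  generalize halvesEquiv (k + 2) x = y
  obtain ⟨y, z⟩ := y
  simp only [separateEquiv, sumDiffEquiv, LinearEquiv.coe_mk, LinearMap.coe_mk, AddHom.coe_mk,
    LinearEquiv.prodCongr_apply, coupledMap, ← map_smul, Finset.sum_sub_distrib,
    ← Finset.mul_sum, Finset.sum_const, Finset.card_univ, Fintype.card_fin, nsmul_eq_mul]
  refine Prod.ext ?_ ?_
  · ext <;> dsimp only <;> ring
  · refine congrArg (halvesEquiv k).symm (Prod.ext (funext fun i => ?_) (funext fun i => ?_)) <;>
      simp only [Prod.smul_mk, Pi.smul_apply, smul_eq_mul] <;> ring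

/-- The critical group for edge multiplicity `r * l` and cone parameter `r * n`, where `l` and `n`
are coprime and `t` is the greatest common divisor of `(k + 2) * l = t * k₁` and `n = t * n₁`. -/
lemma nonempty_coker_equiv_of_factorization (k r t l n N n₁ k₁ : ℕ)
    (hN : N = n + (k + 2) * l) (hn : n = t * n₁) (hk : (k + 2) * l = t * k₁)
    (hln : Nat.Coprime l n) (hkn : Nat.Coprime k₁ n₁) :
    Nonempty
      (((Fin (2 * (k + 2)) → ℤ) ⧸
          LinearMap.range (Matrix.toLin' (coneKmmLap (k + 2) (r * l) (r * n))ᵀ)) ≃+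
        ((ZMod r × ZMod r) × (Fin (2 * k) → ZMod (r * N)) × ZMod (r * N * t) ×
          ZMod (r * N * t * n₁ * (n₁ + 2 * k₁)))) := by
  obtain ⟨u, v, huv⟩ : IsCoprime (l : ℤ) (N : ℤ) := by
    rw [Nat.isCoprime_iff_coprime, hN]
    simpa using hln
  obtain ⟨a, b, hab⟩ := Nat.isCoprime_iff_coprime.2 hkn
  refine nonempty_coker_equiv_of_ladder _ _ _
    (coordEquiv k ≪≫ₗ (targetEquiv N u ((k + 2 : ℕ) * l) a b n₁ k₁ hab).prodCongr
      (LinearEquiv.refl ℤ _))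
    (Prod.map (sourceMap N l u v a b n₁) id ∘ coordEquiv k)
    (((sourceMap_surjective N l u v a b n₁ huv).prodMap Function.surjective_id).comp
      (coordEquiv k).surjective)
    (diagonalCoker_surjective _ _ _ _ _ _) (exact_diagonalMap_diagonalCoker _ _ _ _ _ _)
    fun x => ?_
  have key := targetEquiv_coupledMap r t N l ((k + 2 : ℕ) * l) u v a b n₁ k₁
    (by rw [hN, hn, hk]; push_cast; ring) (by exact_mod_cast hk) huv hab (coordEquiv k x).1
  rw [LinearEquiv.trans_apply, coordEquiv_coneKmmLap, LinearEquiv.prodCongr_apply]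
  have e₁ : ((r * n : ℕ) : ℤ) + (k + 2 : ℕ) * (r * l : ℕ) = r * N := by
    rw [hN]; push_cast; ring
  have e₂ : ((k + 2 : ℕ) : ℤ) * (r * l : ℕ) = r * ((k + 2 : ℕ) * l) := by
    push_cast; ring
  rw [e₁, e₂, Nat.cast_mul r l, key]
  ext <;> simp [diagonalMap] <;> ring

/-- Let `r = gcd(l,n)` and `s = gcd(m·l, n)`.  The critical group of the
`n`-cone of `K_{m,m}(l)`, i.e. the cokernel
`ℤ^{2m} / ((n+m·l)·I - l·A(K_{m,m}))ᵀ ℤ^{2m}`, is isomorphic to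
`(ℤ_r)² ⊕ (ℤ_{n+m·l})^(2(m-2)) ⊕ ℤ_{(n+m·l)·s/r} ⊕ ℤ_{n·(n+m·l)·(n+2m·l)/(r·s)}`. -/
theorem criticalGroup_cone_completeBipartite (m l n : ℕ) (hm : 2 ≤ m) (hl : 1 ≤ l) :
    Nonempty
      (((Fin (2 * m) → ℤ) ⧸
          LinearMap.range (Matrix.toLin' (coneKmmLap m l n)ᵀ)) ≃+
        ((ZMod (Nat.gcd l n) × ZMod (Nat.gcd l n)) ×
          (Fin (2 * (m - 2)) → ZMod (n + m * l)) ×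
          ZMod ((n + m * l) * Nat.gcd (m * l) n / Nat.gcd l n) ×
          ZMod (n * (n + m * l) * (n + 2 * m * l) /
            (Nat.gcd l n * Nat.gcd (m * l) n)))) := by
  obtain ⟨k, rfl⟩ := Nat.exists_eq_add_of_le' hm
  have hl' := Nat.gcd_pos_of_pos_left n hl
  obtain ⟨r, l, n, hr, hln, rfl, rfl⟩ := Nat.exists_coprime' hl'
  have hlpos : 0 < l := Nat.pos_of_mul_pos_right hl
  obtain ⟨t, k₁, n₁, ht, hkn, hk, rfl⟩ := Nat.exists_coprime'
    (Nat.gcd_pos_of_pos_left n (Nat.mul_pos (Nat.succ_pos (k + 1)) hlpos))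
  have hgr : Nat.gcd (l * r) (n₁ * t * r) = r := by
    rw [Nat.gcd_mul_right, hln, one_mul]
  have hgs : Nat.gcd ((k + 2) * (l * r)) (n₁ * t * r) = t * r := by
    rw [← mul_assoc, hk, Nat.gcd_mul_right, Nat.gcd_mul_right, hkn, one_mul]
  have h₁ : n₁ * t * r + (k + 2) * (l * r) = r * (n₁ * t + (k + 2) * l) := by ring
  have h₂ : n₁ * t * r + 2 * (k + 2) * (l * r) = t * r * (n₁ + 2 * k₁) := by
    rw [mul_assoc 2, ← mul_assoc (k + 2), hk]
    ring
  have h₃ : (n₁ * t * r + (k + 2) * (l * r)) * (t * r) / r =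
      r * (n₁ * t + (k + 2) * l) * t := by
    rw [h₁, ← mul_assoc, Nat.mul_div_cancel _ hr]
  have h₄ : n₁ * t * r * (n₁ * t * r + (k + 2) * (l * r)) *
      (n₁ * t * r + 2 * (k + 2) * (l * r)) / (r * (t * r)) =
      r * (n₁ * t + (k + 2) * l) * t * n₁ * (n₁ + 2 * k₁) := by
    refine Nat.div_eq_of_eq_mul_left (by positivity) ?_
    rw [h₁, h₂]
    ring
  rw [hgr, hgs, h₃, h₄, h₁, Nat.add_sub_cancel, mul_comm l r, mul_comm (n₁ * t) r]
  exact nonempty_coker_equiv_of_factorization k r t l (n₁ * t) _ n₁ k₁ rfl (mul_comm _ _)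
    (hk.trans (mul_comm _ _)) hln hkn
end
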